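/- arXiv:math/0408417 — 4 statements merged into one kernel-verified Lean document; each statement's English description precedes it below -/
import Mathlib

section
/- For every n ≥ 1, the n-th symmetric product of the real projective plane is homeomorphic to real projective 2n-space: SP^n(ℝP²) ≃ ℝP^{2n}, i.e. there is a homeomorphism between the quotient of (Projectivization ℝ (Fin 3 → ℝ))^n by the permutation action of S_n and Projectivization ℝ (Fin (2*n+1) → ℝ). -/
/-- The setoid on `Fin n → X` whose classes are orbits of the permutation action
of `Equiv.Perm (Fin n)`. -/
def SPSetoid (n : ℕ) (X : Type*) : Setoid (Fin n → X) where
  r f g := ∃ σ : Equiv.Perm (Fin n), f ∘ σ = g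
  iseqv := by
    constructor
    · exact fun f => ⟨Equiv.refl _, rfl⟩
    · rintro f g ⟨σ, rfl⟩
      exact ⟨σ.symm, by funext i; simp⟩
    · rintro f g h ⟨σ, rfl⟩ ⟨τ, rfl⟩
      exact ⟨τ.trans σ, by funext i; simp⟩

/-- The `n`-th symmetric product `SP^n(X) = X^n / S_n`, with the quotient topology. -/
def SP (n : ℕ) (X : Type*) [TopologicalSpace X] : Type _ :=
  Quotient (SPSetoid n X)

instance (n : ℕ) (X : Type*) [TopologicalSpace X] : TopologicalSpace (SP n X) :=
  inferInstanceAs (TopologicalSpace (Quotient (SPSetoid n X)))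


open Projectivization in
/-- The quotient topology on a projectivization, coming from the topology on
`{v : V // v ≠ 0}`. -/
instance (K V : Type*) [DivisionRing K] [AddCommGroup V] [Module K V]
    [TopologicalSpace V] : TopologicalSpace (Projectivization K V) :=
  inferInstanceAs (TopologicalSpace (Quotient (projectivizationSetoid K V)))


namespace SPProof

open Polynomial Topology

section top

variable {V : Type*} [NormedAddCommGroup V] [NormedSpace ℝ V]

theorem isOpenQuotientMap_mk' : IsOpenQuotientMap (Projectivization.mk' ℝ (V := V)) := by
  refine ⟨?_, ?_, ?_⟩
  · intro x
    exact ⟨⟨x.rep, x.rep_nonzero⟩, x.mk_rep⟩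
  · exact continuous_quotient_mk'
  · intro U hU
    change IsOpen (Projectivization.mk' ℝ (V := V) ⁻¹' _)
    have : Projectivization.mk' ℝ (V := V) ⁻¹' (Projectivization.mk' ℝ '' U) =
        ⋃ r : ℝˣ, (fun v : {v : V // v ≠ 0} =>
          (⟨r • (v : V), by simpa [Units.smul_def] using v.2⟩ : {v : V // v ≠ 0})) ⁻¹' U := by
      ext v
      simp only [Set.mem_preimage, Set.mem_image, Set.mem_iUnion]
      constructor
      · rintro ⟨w, hw, h⟩
        rw [Projectivization.mk'_eq_mk, Projectivization.mk'_eq_mk,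
          Projectivization.mk_eq_mk_iff] at h
        obtain ⟨a, ha⟩ := h
        refine ⟨a, ?_⟩
        convert hw
      · rintro ⟨r, hr⟩
        refine ⟨_, hr, ?_⟩
        rw [Projectivization.mk'_eq_mk, Projectivization.mk'_eq_mk,
          Projectivization.mk_eq_mk_iff]
        exact ⟨r, rfl⟩
    rw [this]
    refine isOpen_iUnion fun r => hU.preimage ?_
    refine Continuous.subtype_mk ?_ _
    simp only [Units.smul_def]
    fun_prop

instance compact_proj [ProperSpace V] : CompactSpace (Projectivization ℝ V) := by
  have hs : IsCompact (Metric.sphere (0 : V) 1) := isCompact_sphere 0 1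
  have : CompactSpace (Metric.sphere (0 : V) 1) := isCompact_iff_compactSpace.mp hs
  let f : Metric.sphere (0 : V) 1 → Projectivization ℝ V := fun v =>
    Projectivization.mk' ℝ ⟨v, by
      have := v.2
      intro h
      simp [h] at this⟩
  have hf : Continuous f :=
    isOpenQuotientMap_mk'.continuous.comp (Continuous.subtype_mk continuous_subtype_val _)
  have hsurj : Function.Surjective f := by
    intro x
    induction x using Projectivization.ind with
    | h v hv =>
      have hn : ‖v‖ ≠ 0 := by simpa using hv
      refine ⟨⟨‖v‖⁻¹ • v, by simp [norm_smul, hn]⟩, ?_⟩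
      simp only [f, Projectivization.mk'_eq_mk]
      rw [Projectivization.mk_eq_mk_iff']
      exact ⟨‖v‖⁻¹, rfl⟩
  exact hsurj.compactSpace hf

instance t2_proj {m : ℕ} : T2Space (Projectivization ℝ (Fin m → ℝ)) := by
  rw [t2Space_iff_of_isOpenQuotientMap isOpenQuotientMap_mk']
  have : {q : {v : Fin m → ℝ // v ≠ 0} × {v : Fin m → ℝ // v ≠ 0} |
      Projectivization.mk' ℝ q.1 = Projectivization.mk' ℝ q.2} =
      ⋂ i, ⋂ j, {q | q.1.1 i * q.2.1 j = q.1.1 j * q.2.1 i} := by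
    ext ⟨⟨v, hv⟩, ⟨w, hw⟩⟩
    simp only [Set.mem_ofPred_eq, Set.mem_iInter, Projectivization.mk'_eq_mk]
    rw [Projectivization.mk_eq_mk_iff']
    constructor
    · rintro ⟨a, rfl⟩ i j
      simp only [Pi.smul_apply, smul_eq_mul]; ring
    · intro h
      obtain ⟨j, hj⟩ := Function.ne_iff.mp hw
      simp only [Pi.zero_apply] at hj
      refine ⟨v j / w j, ?_⟩
      ext i
      simp only [Pi.smul_apply, smul_eq_mul]
      have := h i j
      field_simp
      linarith
  rw [this]
  refine isClosed_iInter fun i => isClosed_iInter fun j => isClosed_eq ?_ ?_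
  · exact ((continuous_apply i).comp (continuous_subtype_val.comp continuous_fst)).mul
      ((continuous_apply j).comp (continuous_subtype_val.comp continuous_snd))
  · exact ((continuous_apply j).comp (continuous_subtype_val.comp continuous_fst)).mul
      ((continuous_apply i).comp (continuous_subtype_val.comp continuous_snd))

end top

noncomputable section

/-- The binary quadratic form (dehomogenised) attached to a vector of `ℝ³`. -/
def quad (v : Fin 3 → ℝ) : ℂ[X] :=
  C (v 0 + v 1 * Complex.I) + C (2 * v 2 : ℂ) * X - C (v 0 - v 1 * Complex.I) * X ^ 2

/-- The twisted reflection on polynomials of degree at most `N`. -/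
def tau (N : ℕ) (P : ℂ[X]) : ℂ[X] := reflect N ((P.map (starRingEnd ℂ)).comp (C (-1) * X))

theorem tau_mul {M N : ℕ} {f g : ℂ[X]} (hf : f.natDegree ≤ M) (hg : g.natDegree ≤ N) :
    tau (M + N) (f * g) = tau M f * tau N g := by
  unfold tau
  rw [Polynomial.map_mul, mul_comp, reflect_mul]
  · refine (natDegree_comp_le).trans ?_
    rw [natDegree_C_mul_X _ (by norm_num)]; simpa using hf
  · refine (natDegree_comp_le).trans ?_
    rw [natDegree_C_mul_X _ (by norm_num)]; simpa using hg

theorem tau_coeff (N k : ℕ) (h : k ≤ N) (P : ℂ[X]) :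
    (tau N P).coeff (N - k) = (-1) ^ k * (starRingEnd ℂ) (P.coeff k) := by
  unfold tau
  rw [coeff_reflect, revAt_le (by omega), comp_C_mul_X_coeff, coeff_map, Nat.sub_sub_self h, mul_comm]

theorem quad_natDegree (v) : (quad v).natDegree ≤ 2 := by
  unfold quad; compute_degree

theorem quad_coeff_zero (v) : (quad v).coeff 0 = v 0 + v 1 * Complex.I := by
  simp [quad]
theorem quad_coeff_one (v) : (quad v).coeff 1 = 2 * v 2 := by
  simp [quad, coeff_X, coeff_C, coeff_X_pow, -map_add, -map_sub, -map_mul]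
theorem quad_coeff_two (v) : (quad v).coeff 2 = -(v 0 - v 1 * Complex.I) := by
  simp [quad, coeff_X, coeff_C, coeff_X_pow, -map_add, -map_sub, -map_mul]

theorem quad_tau (v) : tau 2 (quad v) = - quad v := by
  have key : ∀ k ≤ 2, (tau 2 (quad v)).coeff (2 - k) = (-quad v).coeff (2 - k) := by
    intro k hk
    rw [tau_coeff 2 k hk, coeff_neg]
    interval_cases k
    · simp [quad_coeff_zero, quad_coeff_two]
      ring
    · simp [quad_coeff_one]
      left; exact map_ofNat _ 2
    · simp [quad_coeff_zero, quad_coeff_two]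
      ring
  ext m
  by_cases hm : m ≤ 2
  · have := key (2 - m) (by omega)
    rwa [Nat.sub_sub_self hm] at this
  · have h1 : (quad v).coeff m = 0 :=
      coeff_eq_zero_of_natDegree_lt (lt_of_le_of_lt (quad_natDegree v) (by omega))
    rw [coeff_neg, h1, tau, coeff_reflect, revAt_eq_self_of_lt (by omega), comp_C_mul_X_coeff,
      coeff_map, h1]
    simp

theorem quad_smul (r : ℝ) (v) : quad (r • v) = C (r : ℂ) * quad v := by
  simp only [quad, Pi.smul_apply, smul_eq_mul]
  push_cast
  simp only [map_add, map_sub, map_mul]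
  ring

theorem quad_ne_zero {v} (hv : v ≠ 0) : quad v ≠ 0 := by
  intro h
  apply hv
  have h0 := quad_coeff_zero v
  have h1 := quad_coeff_one v
  rw [h] at h0 h1
  simp [Complex.ext_iff] at h0 h1
  ext i; fin_cases i <;> simp [← h0.1, ← h0.2, h1]

/-- Stereographic inverse. -/
def pt (z : ℂ) : Fin 3 → ℝ := ![-2 * z.re, -2 * z.im, 1 - z.re ^ 2 - z.im ^ 2]

theorem pt_ne_zero (z) : pt z ≠ 0 := by
  intro h
  have h0 := congrFun h 0
  have h1 := congrFun h 1
  have h2 := congrFun h 2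
  simp [pt] at h0 h1 h2
  simp [h0, h1] at h2

theorem quad_pt (z : ℂ) : quad (pt z) = C 2 * ((X - C z) * (C (starRingEnd ℂ z) * X + 1)) := by
  have h1 : (C (starRingEnd ℂ z) : ℂ[X]) * C z = C ((z.re ^ 2 + z.im ^ 2 : ℝ) : ℂ) := by
    rw [← C_mul]; congr 1
    apply Complex.ext <;> simp [← Complex.ofReal_pow] <;> ring
  have h2 : (pt z 0 + pt z 1 * Complex.I : ℂ) = -2 * z := by
    apply Complex.ext <;> simp [pt]
  have h3 : (pt z 0 - pt z 1 * Complex.I : ℂ) = -2 * starRingEnd ℂ z := by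
    apply Complex.ext <;> simp [pt]
  have h4 : (2 * pt z 2 : ℂ) = 2 * (1 - ((z.re ^ 2 + z.im ^ 2 : ℝ) : ℂ)) := by
    simp [pt]; ring
  unfold quad
  rw [h2, h3, h4]
  simp only [map_mul, map_sub, map_neg, map_one, ← h1]
  ring

theorem exists_root (v) : ∃ z, (quad v).IsRoot z := by
  by_cases h : v 0 = 0 ∧ v 1 = 0
  · exact ⟨0, by simp [quad, h]⟩
  · apply IsAlgClosed.exists_root
    have : (quad v).coeff 2 ≠ 0 := by
      rw [quad_coeff_two]
      intro h'
      simp [Complex.ext_iff] at h'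
      exact h h'
    intro hd
    have := le_degree_of_ne_zero this
    rw [hd] at this
    exact absurd this (by decide)

theorem eq_smul_pt {v z} (h : (quad v).IsRoot z) : ∃ r : ℝ, v = r • pt z := by
  obtain ⟨x, y⟩ := z
  simp [quad, Complex.ext_iff, pow_two] at h
  obtain ⟨h0, h1⟩ := h
  have hK : v 1 * x - v 0 * y = 0 := by
    have : (v 1 * x - v 0 * y) * (1 + x ^ 2 + y ^ 2) = 0 := by
      linear_combination x * h1 - y * h0
    exact (mul_eq_zero.mp this).resolve_right (by positivity)
  have F0 : v 0 * (1 - x ^ 2 - y ^ 2) + 2 * v 2 * x = 0 := by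
    linear_combination h0 + 2 * y * hK
  have F1 : v 1 * (1 - x ^ 2 - y ^ 2) + 2 * v 2 * y = 0 := by
    linear_combination h1 - 2 * x * hK
  -- candidate: r = <v, pt z> / |pt z|^2
  have hD : (1 + x ^ 2 + y ^ 2) ≠ 0 := by positivity
  refine ⟨(-2 * x * v 0 - 2 * y * v 1 + (1 - x ^ 2 - y ^ 2) * v 2) / (1 + x ^ 2 + y ^ 2) ^ 2, ?_⟩
  ext i
  fin_cases i <;> simp [pt] <;> field_simp
  · linear_combination (1 - x ^ 2 - y ^ 2) * F0 - 4 * y * hK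
  · linear_combination (1 - x ^ 2 - y ^ 2) * F1 + 4 * x * hK
  · linear_combination 2 * x * F0 + 2 * y * F1

theorem exists_perm {n : ℕ} {X : Type*} (f g : Fin n → X)
    (h : Finset.univ.val.map f = Finset.univ.val.map g) :
    ∃ σ : Equiv.Perm (Fin n), f ∘ σ = g := by
  classical
  have hc : ∀ c, Nonempty ({a // g a = c} ≃ {b // f b = c}) := fun c => by
    apply Fintype.card_eq.mp
    have := congrArg (Multiset.count c) h
    rw [Multiset.count_map, Multiset.count_map] at this
    rw [Fintype.card_subtype, Fintype.card_subtype]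
    simp only [eq_comm (a := c)] at this
    exact this.symm
  refine ⟨Equiv.ofFiberEquiv fun c => (hc c).some, ?_⟩
  funext a
  exact Equiv.ofFiberEquiv_map _ a

/-- Nonzero vectors of `ℝ³`. -/
abbrev W := {v : Fin 3 → ℝ // v ≠ 0}

/-- The product of the quadratic forms of a multiset of vectors. -/
def prodQ (s : Multiset W) : ℂ[X] := (s.map (fun v : W => quad v)).prod

theorem prodQ_ne_zero (s : Multiset W) : prodQ s ≠ 0 := by
  refine Multiset.prod_ne_zero ?_
  intro h
  obtain ⟨v, -, hv⟩ := Multiset.mem_map.mp h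
  exact quad_ne_zero v.2 hv

theorem prodQ_cons (v : W) (s : Multiset W) : prodQ (v ::ₘ s) = quad v * prodQ s := by
  simp [prodQ]

theorem prodQ_inj (s : Multiset W) : ∀ (t : Multiset W) (lam : ℝ), lam ≠ 0 →
    s.card = t.card → prodQ s = C (lam : ℂ) * prodQ t →
    s.map (Projectivization.mk' ℝ) = t.map (Projectivization.mk' ℝ) := by
  induction s using Multiset.induction_on with
  | empty =>
    intro t lam _ hc _
    have : t = 0 := Multiset.card_eq_zero.mp hc.symm
    simp [this]
  | cons v s ih =>
    intro t lam hl hc h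
    obtain ⟨z, hz⟩ := exists_root v.1
    have h1 : (prodQ t).eval z = 0 := by
      have := congrArg (eval z) h
      rw [prodQ_cons, eval_mul, eval_mul, hz.eq_zero, zero_mul, eval_C] at this
      rcases mul_eq_zero.mp this.symm with h | h
      · exact absurd (by exact_mod_cast h) hl
      · exact h
    have h2 : ∃ w ∈ t, (quad w.1).IsRoot z := by
      unfold prodQ at h1
      rw [eval_multiset_prod, Multiset.prod_eq_zero_iff] at h1
      simpa using h1
    obtain ⟨w, hw, hwz⟩ := h2
    obtain ⟨t', rfl⟩ := Multiset.exists_cons_of_mem hw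
    obtain ⟨a, ha⟩ := eq_smul_pt hz
    obtain ⟨b, hb⟩ := eq_smul_pt hwz
    have ha0 : a ≠ 0 := by rintro rfl; exact v.2 (by simpa using ha)
    have hb0 : b ≠ 0 := by rintro rfl; exact w.2 (by simpa using hb)
    have hvw : v.1 = (a / b) • w.1 := by
      rw [ha, hb, smul_smul, div_mul_cancel₀ _ hb0]
    have hr : a / b ≠ 0 := div_ne_zero ha0 hb0
    rw [Multiset.map_cons, Multiset.map_cons]
    congr 1
    · rw [Projectivization.mk'_eq_mk, Projectivization.mk'_eq_mk, Projectivization.mk_eq_mk_iff']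
      exact ⟨_, hvw.symm⟩
    · refine ih t' (lam / (a / b)) (div_ne_zero hl hr) (by simpa using hc) ?_
      rw [prodQ_cons, prodQ_cons, hvw, quad_smul] at h
      have hC : (C ((a / b : ℝ) : ℂ) : ℂ[X]) ≠ 0 := by
        rw [Ne, C_eq_zero]; exact_mod_cast hr
      apply mul_left_cancel₀ (mul_ne_zero hC (quad_ne_zero w.2))
      rw [h]
      have : (lam : ℂ) = ((a / b : ℝ) : ℂ) * ((lam / (a / b) : ℝ) : ℂ) := by
        rw [← Complex.ofReal_mul, mul_div_cancel₀ _ hr]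
      rw [this, C_mul]
      ring

/-- The reality condition. -/
def Sym (n : ℕ) (P : ℂ[X]) : Prop := P.natDegree ≤ 2 * n ∧ tau (2 * n) P = C ((-1) ^ n) * P

theorem Sym.coeff {n : ℕ} {P : ℂ[X]} (h : Sym n P) (k : ℕ) (hk : k ≤ 2 * n) :
    P.coeff (2 * n - k) = (-1) ^ (n + k) * starRingEnd ℂ (P.coeff k) := by
  have := tau_coeff (2 * n) k hk P
  rw [h.2, coeff_C_mul] at this
  rw [pow_add, mul_assoc, ← this, ← mul_assoc, ← mul_pow]
  simp

theorem sym_of_coeff {n : ℕ} {P : ℂ[X]} (hd : P.natDegree ≤ 2 * n)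
    (h : ∀ k ≤ 2 * n, P.coeff (2 * n - k) = (-1) ^ (n + k) * starRingEnd ℂ (P.coeff k)) :
    Sym n P := by
  refine ⟨hd, ?_⟩
  ext m
  by_cases hm : m ≤ 2 * n
  · have h1 := tau_coeff (2 * n) (2 * n - m) (by omega) P
    have h2 := h (2 * n - m) (by omega)
    rw [Nat.sub_sub_self hm] at h1 h2
    rw [h1, coeff_C_mul, h2, pow_add, ← mul_assoc, ← mul_assoc, ← mul_pow]
    simp
  · have h1 : P.coeff m = 0 := coeff_eq_zero_of_natDegree_lt (lt_of_le_of_lt hd (by omega))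
    rw [coeff_C_mul, h1, tau, coeff_reflect, revAt_eq_self_of_lt (by omega), comp_C_mul_X_coeff,
      coeff_map, h1]
    simp

theorem sym_prodQ (s : Multiset W) : Sym s.card (prodQ s) := by
  induction s using Multiset.induction_on with
  | empty =>
    simp [prodQ, Sym, tau]
  | cons v s ih =>
    rw [prodQ_cons, Multiset.card_cons]
    refine ⟨natDegree_mul_le.trans ?_, ?_⟩
    · have := quad_natDegree v.1
      have := ih.1
      omega
    · rw [show 2 * (s.card + 1) = 2 + 2 * s.card by ring, tau_mul (quad_natDegree _) ih.1,
        quad_tau, ih.2, pow_succ]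
      simp only [map_mul, map_neg, map_one]
      ring

theorem tau_linear (z : ℂ) : tau 1 (X - C z) = - (C (starRingEnd ℂ z) * X + 1) := by
  unfold tau
  simp only [Polynomial.map_sub, map_X, map_C, sub_comp, X_comp, C_comp, reflect_sub, reflect_C_mul,
    reflect_one_X, reflect_C]
  simp
  ring

theorem sym_step {n : ℕ} {P : ℂ[X]} (hP : P ≠ 0) (h : Sym (n + 1) P) :
    ∃ (z : ℂ) (Q : ℂ[X]), Sym n Q ∧ P = quad (pt z) * Q := by
  have hdeg : P.degree ≠ 0 := by
    intro hd
    have h0 := h.coeff 0 (by omega)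
    have hc := eq_C_of_degree_eq_zero hd
    rw [hc] at h0
    rw [coeff_C_of_ne_zero (by omega)] at h0
    apply hP
    rw [hc]
    simpa using h0.symm
  obtain ⟨z, hz⟩ := IsAlgClosed.exists_root P hdeg
  have d1 : (X - C z) ∣ P := dvd_iff_isRoot.mpr hz
  have d2 : (C (starRingEnd ℂ z) * X + 1) ∣ P := by
    obtain ⟨R, hR⟩ := d1
    have hRd : R.natDegree ≤ 2 * n + 1 := by
      have h1 := h.1
      have hR0 : R ≠ 0 := by rintro rfl; simp [hR] at hP
      rw [hR, natDegree_mul (X_sub_C_ne_zero z) hR0, natDegree_X_sub_C] at h1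
      omega
    have h2 := h.2
    have h3 := tau_mul (natDegree_X_sub_C_le z) hRd
    rw [← hR, show 1 + (2 * n + 1) = 2 * (n + 1) by ring, h2, tau_linear] at h3
    refine ⟨C ((-1) ^ n) * tau (2 * n + 1) R, ?_⟩
    have h4 : (C ((-1) ^ (n + 1)) : ℂ[X]) * C ((-1) ^ (n + 1)) = 1 := by
      rw [← C_mul, ← mul_pow]; simp
    calc P = C ((-1) ^ (n + 1)) * (C ((-1) ^ (n + 1)) * P) := by rw [← mul_assoc, h4, one_mul]
      _ = _ := by
        rw [h3, pow_succ]
        simp only [map_mul, map_neg, map_one]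
        ring
  have cop : IsCoprime (X - C z) (C (starRingEnd ℂ z) * X + 1) := by
    have hne : ((1 + z.re ^ 2 + z.im ^ 2 : ℝ) : ℂ) ≠ 0 := by
      norm_cast; positivity
    have e1 : (1 + starRingEnd ℂ z * z) = ((1 + z.re ^ 2 + z.im ^ 2 : ℝ) : ℂ) := by
      apply Complex.ext <;> simp [← Complex.ofReal_pow] <;> ring
    rw [← e1] at hne
    refine ⟨- C ((1 + starRingEnd ℂ z * z)⁻¹) * C (starRingEnd ℂ z),
      C ((1 + starRingEnd ℂ z * z)⁻¹), ?_⟩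
    have e2 : (C ((1 + starRingEnd ℂ z * z)⁻¹) : ℂ[X]) * (1 + C (starRingEnd ℂ z) * C z) = 1 := by
      rw [← C_mul, ← C_1, ← C_add, ← C_mul, inv_mul_cancel₀ hne]
    linear_combination e2
  have d3 : quad (pt z) ∣ P := by
    rw [quad_pt]
    have hu : IsUnit (C 2 : ℂ[X]) := isUnit_C.mpr (by simp)
    rw [hu.mul_left_dvd]
    exact cop.mul_dvd d1 d2
  obtain ⟨Q, hQ⟩ := d3
  refine ⟨z, Q, ?_, hQ⟩
  have hq0 := quad_ne_zero (pt_ne_zero z)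
  have hQ0 : Q ≠ 0 := by rintro rfl; simp [hQ] at hP
  have hQd : Q.natDegree ≤ 2 * n := by
    have e := congrArg natDegree hQ
    rw [natDegree_mul hq0 hQ0] at e
    by_cases hz0 : z = 0
    · subst hz0
      have q1 : (quad (pt 0)).natDegree = 1 := by
        rw [quad_pt]; simp
      have c0 : P.coeff 0 = 0 := by rw [coeff_zero_eq_eval_zero]; exact hz
      have c1 := h.coeff 0 (by omega)
      rw [c0] at c1
      simp only [map_zero, mul_zero, Nat.sub_zero] at c1
      have : P.natDegree ≠ 2 * (n + 1) := by
        intro h'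
        rw [← h'] at c1
        exact hP (leadingCoeff_eq_zero.mp c1)
      have := h.1
      omega
    · have q2 : 2 ≤ (quad (pt z)).natDegree := by
        apply le_natDegree_of_ne_zero
        rw [quad_coeff_two]
        intro h'
        apply hz0
        simp [Complex.ext_iff, pt] at h'
        exact Complex.ext h'.1 h'.2
      have := h.1
      omega
  refine ⟨hQd, ?_⟩
  have h2 := h.2
  rw [hQ, show 2 * (n + 1) = 2 + 2 * n by ring, tau_mul (quad_natDegree _) hQd, quad_tau] at h2
  apply mul_left_cancel₀ (neg_ne_zero.mpr hq0)
  rw [h2, pow_succ]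
  simp only [map_mul, map_neg, map_one]
  ring

theorem prodQ_surj (n : ℕ) : ∀ P : ℂ[X], P ≠ 0 → Sym n P →
    ∃ s : Multiset W, s.card = n ∧ ∃ r : ℝ, r ≠ 0 ∧ P = C (r : ℂ) * prodQ s := by
  induction n with
  | zero =>
    intro P hP h
    have hc := eq_C_of_natDegree_le_zero h.1
    have h0 := h.coeff 0 (by omega)
    simp only [mul_zero, Nat.sub_zero, add_zero, pow_zero, one_mul] at h0
    obtain ⟨r, hr⟩ := Complex.conj_eq_iff_real.mp h0.symm
    rw [hr] at hc
    refine ⟨0, rfl, r, ?_, by simpa [prodQ] using hc⟩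
    rintro rfl
    simp at hc
    exact hP hc
  | succ n ih =>
    intro P hP h
    obtain ⟨z, Q, hQ, rfl⟩ := sym_step hP h
    obtain ⟨s, hs, r, hr, rfl⟩ := ih Q (right_ne_zero_of_mul hP) hQ
    refine ⟨⟨pt z, pt_ne_zero z⟩ ::ₘ s, by simp [hs], r, hr, ?_⟩
    rw [prodQ_cons]
    ring

/-- Real coordinates of a polynomial satisfying the reality condition. -/
def coord (n : ℕ) (P : ℂ[X]) : Fin (2 * n + 1) → ℝ := fun j => (P.coeff j).re + (P.coeff j).im

theorem coord_C_mul (n : ℕ) (r : ℝ) (P : ℂ[X]) : coord n (C (r : ℂ) * P) = r • coord n P := by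
  ext j
  simp [coord, coeff_C_mul]
  ring

theorem coord_sub (n : ℕ) (P Q : ℂ[X]) : coord n (P - Q) = coord n P - coord n Q := by
  ext j
  simp [coord]
  ring

theorem tau_sub (N : ℕ) (P Q : ℂ[X]) : tau N (P - Q) = tau N P - tau N Q := by
  simp only [tau, Polynomial.map_sub, sub_comp, reflect_sub]

theorem Sym.sub {n : ℕ} {P Q : ℂ[X]} (hP : Sym n P) (hQ : Sym n Q) : Sym n (P - Q) :=
  ⟨(natDegree_sub_le _ _).trans (max_le hP.1 hQ.1), by rw [tau_sub, hP.2, hQ.2, mul_sub]⟩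

theorem Sym.C_mul {n : ℕ} {P : ℂ[X]} (hP : Sym n P) (r : ℝ) : Sym n (C (r : ℂ) * P) := by
  refine sym_of_coeff ((natDegree_C_mul_le _ _).trans hP.1) fun k hk => ?_
  rw [coeff_C_mul, coeff_C_mul, hP.coeff k hk, map_mul, Complex.conj_ofReal]
  ring

theorem coord_eq_zero {n : ℕ} {P : ℂ[X]} (h : Sym n P) (h0 : coord n P = 0) : P = 0 := by
  have hx : ∀ k ≤ 2 * n, (P.coeff k).re + (P.coeff k).im = 0 := fun k hk =>
    congrFun h0 ⟨k, by omega⟩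
  ext k
  by_cases hk : k ≤ 2 * n
  · have h1 := hx k hk
    have h2 := hx (2 * n - k) (by omega)
    rw [h.coeff k hk] at h2
    have h3 : (P.coeff k).re - (P.coeff k).im = 0 := by
      rcases neg_one_pow_eq_or ℂ (n + k) with e | e <;> rw [e] at h2 <;> simp at h2 <;> linarith
    apply Complex.ext
    · simp; linarith
    · simp; linarith
  · rw [coeff_zero]
    exact coeff_eq_zero_of_natDegree_lt (lt_of_le_of_lt h.1 (by omega))

theorem coord_surj (n : ℕ) (x : Fin (2 * n + 1) → ℝ) : ∃ P, Sym n P ∧ coord n P = x := by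
  let y : ℕ → ℝ := fun k => if h : k < 2 * n + 1 then x ⟨k, h⟩ else 0
  let c : ℕ → ℂ := fun k =>
    ⟨(y k + (-1) ^ (n + k) * y (2 * n - k)) / 2, (y k - (-1) ^ (n + k) * y (2 * n - k)) / 2⟩
  let P : ℂ[X] := ∑ k ∈ Finset.range (2 * n + 1), C (c k) * X ^ k
  have hc : ∀ k ≤ 2 * n, P.coeff k = c k := by
    intro k hk
    simp only [P, finsetSum_coeff, coeff_C_mul, coeff_X_pow]
    simp
    omega
  have hd : P.natDegree ≤ 2 * n := by
    apply natDegree_sum_le_of_forall_le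
    intro k hk
    refine (natDegree_C_mul_X_pow_le _ _).trans ?_
    have := Finset.mem_range.mp hk
    omega
  refine ⟨P, sym_of_coeff hd fun k hk => ?_, ?_⟩
  · rw [hc k hk, hc _ (by omega)]
    have e2 : (-1 : ℝ) ^ (n + (2 * n - k)) = (-1) ^ (n + k) := by
      have : n + (2 * n - k) + (n + k) = 2 * (2 * n) := by omega
      rcases Nat.even_or_odd (n + k) with e | e
      · have e' : Even (n + (2 * n - k)) := by grind
        rw [e.neg_one_pow, e'.neg_one_pow]
      · have e' : Odd (n + (2 * n - k)) := by grind
        rw [e.neg_one_pow, e'.neg_one_pow]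
    simp only [c, Nat.sub_sub_self hk, e2]
    rcases Nat.even_or_odd (n + k) with e | e <;>
    · simp only [e.neg_one_pow]
      apply Complex.ext <;> simp <;> ring
  · ext j
    have hj : (j : ℕ) ≤ 2 * n := by omega
    simp only [coord, hc _ hj, c]
    have : y j = x j := by simp [y]; omega
    rw [this]
    ring

theorem continuous_coeff {n : ℕ} (s : Finset (Fin n)) : ∀ k,
    Continuous fun v : Fin n → W => (∏ i ∈ s, quad (v i).1).coeff k := by
  induction s using Finset.induction_on with
  | empty => intro k; simpa using continuous_const
  | insert a s ha ih =>
    intro k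
    simp only [Finset.prod_insert ha, coeff_mul]
    refine continuous_finsetSum _ fun p _ => Continuous.mul ?_ (ih _)
    have hv : ∀ i, Continuous fun v : Fin n → W => (((v a).1 i : ℝ) : ℂ) := fun i =>
      Complex.continuous_ofReal.comp ((continuous_apply i).comp
        (continuous_subtype_val.comp (continuous_apply a)))
    have h0 := hv 0
    have h1 := hv 1
    have h2 := hv 2
    simp only [quad, coeff_sub, coeff_add, coeff_C_mul, coeff_C]
    refine ((?_ : Continuous _).add (by fun_prop)).sub (by fun_prop)
    split_ifs
    · fun_prop
    · fun_prop

/-- The map on tuples of nonzero vectors. -/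
def F {n : ℕ} (v : Fin n → W) : Fin (2 * n + 1) → ℝ := coord n (∏ i, quad (v i).1)

theorem prod_eq {n : ℕ} (v : Fin n → W) :
    ∏ i, quad (v i).1 = prodQ (Finset.univ.val.map v) := by
  rw [prodQ, Multiset.map_map]; rfl

theorem sym_prod {n : ℕ} (v : Fin n → W) : Sym n (∏ i, quad (v i).1) := by
  have := sym_prodQ (Finset.univ.val.map v)
  rw [← prod_eq] at this
  simpa using this

theorem F_ne_zero {n : ℕ} (v : Fin n → W) : F v ≠ 0 := by
  intro h
  have := coord_eq_zero (sym_prod v) h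
  rw [prod_eq] at this
  exact prodQ_ne_zero _ this

theorem continuous_F {n : ℕ} : Continuous (F (n := n)) := by
  refine continuous_pi fun j => ?_
  have := continuous_coeff (n := n) Finset.univ j
  exact (Complex.continuous_re.comp this).add (Complex.continuous_im.comp this)

theorem F_eq_iff {n : ℕ} (v w : Fin n → W) :
    Projectivization.mk ℝ (F v) (F_ne_zero v) = Projectivization.mk ℝ (F w) (F_ne_zero w) ↔
    ∃ σ : Equiv.Perm (Fin n), (Projectivization.mk' ℝ ∘ v) ∘ σ = Projectivization.mk' ℝ ∘ w := by
  rw [Projectivization.mk_eq_mk_iff']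
  constructor
  · rintro ⟨a, ha⟩
    have ha0 : a ≠ 0 := by
      rintro rfl
      exact F_ne_zero v (by simpa using ha.symm)
    have h1 : C (a : ℂ) * (∏ i, quad (w i).1) - ∏ i, quad (v i).1 = 0 := by
      apply coord_eq_zero (((sym_prod w).C_mul a).sub (sym_prod v))
      rw [coord_sub, coord_C_mul]
      exact sub_eq_zero.mpr ha
    have h2 := (sub_eq_zero.mp h1).symm
    rw [prod_eq, prod_eq] at h2
    have h3 := prodQ_inj _ _ a ha0 (by simp) h2
    rw [Multiset.map_map, Multiset.map_map] at h3
    obtain ⟨σ, hσ⟩ := exists_perm _ _ h3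
    exact ⟨σ, hσ⟩
  · rintro ⟨σ, hσ⟩
    have h1 : ∀ i, ∃ r : ℝ, r • (w i).1 = (v (σ i)).1 := fun i => by
      have := congrFun hσ i
      simp only [Function.comp_apply, Projectivization.mk'_eq_mk] at this
      rwa [Projectivization.mk_eq_mk_iff'] at this
    choose r hr using h1
    refine ⟨∏ i, r i, ?_⟩
    unfold F
    rw [← coord_C_mul]
    congr 1
    rw [← Equiv.prod_comp σ (fun i => quad (v i).1)]
    simp only [← hr, quad_smul, Finset.prod_mul_distrib]
    push_cast
    simp

/-- The map on tuples of points of the projective plane. -/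
def G {n : ℕ} (x : Fin n → Projectivization ℝ (Fin 3 → ℝ)) :
    Projectivization ℝ (Fin (2 * n + 1) → ℝ) :=
  Projectivization.mk ℝ (F fun i => ⟨(x i).rep, (x i).rep_nonzero⟩) (F_ne_zero _)

theorem G_mk {n : ℕ} (v : Fin n → W) :
    G (Projectivization.mk' ℝ ∘ v) = Projectivization.mk ℝ (F v) (F_ne_zero v) := by
  unfold G
  rw [F_eq_iff]
  refine ⟨1, ?_⟩
  ext i
  simp

theorem G_eq_iff {n : ℕ} (x y : Fin n → Projectivization ℝ (Fin 3 → ℝ)) :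
    G x = G y ↔ ∃ σ : Equiv.Perm (Fin n), x ∘ σ = y := by
  have hx : ∀ x : Fin n → Projectivization ℝ (Fin 3 → ℝ),
      ∃ v : Fin n → W, Projectivization.mk' ℝ ∘ v = x := fun x =>
    ⟨fun i => ⟨(x i).rep, (x i).rep_nonzero⟩, by ext i; simp⟩
  obtain ⟨v, rfl⟩ := hx x
  obtain ⟨w, rfl⟩ := hx y
  rw [G_mk, G_mk, F_eq_iff]

theorem G_surj {n : ℕ} : Function.Surjective (G (n := n)) := by
  intro p
  induction p using Projectivization.ind with
  | h x hx =>
    obtain ⟨P, hP, rfl⟩ := coord_surj n x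
    have hP0 : P ≠ 0 := by
      rintro rfl
      exact hx (by ext j; simp [coord])
    obtain ⟨s, hs, r, hr, rfl⟩ := prodQ_surj n P hP0 hP
    obtain ⟨v, rfl⟩ : ∃ v : Fin n → W, Finset.univ.val.map v = s := by
      subst hs
      induction s using Quotient.inductionOn with
      | h l => exact ⟨l.get, (Fin.univ_val_map l.get).trans (congrArg _ (List.ofFn_get l))⟩
    refine ⟨Projectivization.mk' ℝ ∘ v, ?_⟩
    rw [G_mk, Projectivization.mk_eq_mk_iff']
    refine ⟨r⁻¹, ?_⟩
    rw [coord_C_mul, smul_smul, inv_mul_cancel₀ hr, one_smul, F, prod_eq]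

theorem continuous_G {n : ℕ} : Continuous (G (n := n)) := by
  have hq : IsOpenQuotientMap (Pi.map fun _ : Fin n => Projectivization.mk' ℝ (V := Fin 3 → ℝ)) :=
    IsOpenQuotientMap.piMap fun _ => isOpenQuotientMap_mk'
  rw [← hq.continuous_comp_iff]
  have : G ∘ (Pi.map fun _ : Fin n => Projectivization.mk' ℝ (V := Fin 3 → ℝ)) =
      fun v => Projectivization.mk' ℝ ⟨F v, F_ne_zero v⟩ := by
    funext v
    exact G_mk v
  rw [this]
  exact isOpenQuotientMap_mk'.continuous.comp (continuous_F.subtype_mk _)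

end

end SPProof

/-- The `n`-th symmetric product of the real projective plane `ℝP²` is homeomorphic
to real projective `2n`-space `ℝP^{2n}`. -/
theorem SP_realProjectivePlane_homeomorph_projectiveSpace (n : ℕ) (hn : 1 ≤ n) :
    Nonempty (SP n (Projectivization ℝ (Fin 3 → ℝ)) ≃ₜ
      Projectivization ℝ (Fin (2 * n + 1) → ℝ)) := by
  let H : SP n (Projectivization ℝ (Fin 3 → ℝ)) → Projectivization ℝ (Fin (2 * n + 1) → ℝ) :=
    Quotient.lift SPProof.G fun x y h => (SPProof.G_eq_iff x y).mpr h
  have hH : Continuous H := SPProof.continuous_G.quotient_lift _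
  have hbij : Function.Bijective H := by
    constructor
    · intro a b
      refine Quotient.inductionOn₂ a b fun x y h => ?_
      exact Quotient.sound ((SPProof.G_eq_iff x y).mp h)
    · intro p
      obtain ⟨x, hx⟩ := SPProof.G_surj p
      exact ⟨Quotient.mk _ x, hx⟩
  have : CompactSpace (SP n (Projectivization ℝ (Fin 3 → ℝ))) :=
    inferInstanceAs (CompactSpace (Quotient (SPSetoid n (Projectivization ℝ (Fin 3 → ℝ)))))
  exact ⟨Continuous.homeoOfEquivCompactToT2 (f := Equiv.ofBijective H hbij) hH⟩
end

section
/- Let n ≥ 1 and let v₁, ..., vₙ be vectors in ℝ³ (EuclideanSpace ℝ (Fin 3)). Define f₀ : ℝ³ \ {0} → ℝ by f₀(x) = ‖x‖⁻¹ and inductively f_k(x) = (fderiv ℝ f_{k−1} x)(v_k), the directional derivative of f_{k−1} along the constant vector field v_k. Then there exists a polynomial P in three real variables (an MvPolynomial (Fin 3) ℝ) which is homogeneous of degree n and harmonic (∑_{i<3} ∂²P/∂x_i² = 0), such that for every x ≠ 0, f_n(x) = P(x) / ‖x‖^{2n+1}. -/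
/-- The iterated directional derivative of the function `x ↦ ‖x‖⁻¹` on `ℝ³` along a
tuple of constant vector fields `v₁, …, vₙ`: with `f₀(x) = ‖x‖⁻¹` and
`f_k(x) = (fderiv ℝ f_{k−1} x)(v_k)`, this is `f_n`. -/
noncomputable def iterDirDeriv {n : ℕ} (v : Fin n → EuclideanSpace ℝ (Fin 3)) :
    EuclideanSpace ℝ (Fin 3) → ℝ :=
  (List.ofFn v).foldl (fun f u => fun x => fderiv ℝ f x u) (fun x => ‖x‖⁻¹)

open MvPolynomial in
theorem aux_pderiv_comm (i j : Fin 3) (p : MvPolynomial (Fin 3) ℝ) :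
    pderiv i (pderiv j p) = pderiv j (pderiv i p) := by
  have h : ⁅(pderiv i : Derivation ℝ (MvPolynomial (Fin 3) ℝ) (MvPolynomial (Fin 3) ℝ)),
      (pderiv j : Derivation ℝ (MvPolynomial (Fin 3) ℝ) (MvPolynomial (Fin 3) ℝ))⁆ = 0 := by
    apply MvPolynomial.derivation_ext
    intro k
    rw [Derivation.commutator_apply]
    simp only [pderiv_X, Pi.single_apply]
    split_ifs <;> simp
  have := congrArg (fun D => D p) h
  simp only [Derivation.commutator_apply, Derivation.coe_zero, Pi.zero_apply] at this
  exact sub_eq_zero.mp this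

set_option maxHeartbeats 4000000 in
open MvPolynomial in
theorem aux_harm (k : ℕ) (P : MvPolynomial (Fin 3) ℝ) (hP : P.IsHomogeneous k)
    (hΔ : (∑ i : Fin 3, pderiv i (pderiv i P)) = 0) (a : Fin 3 → ℝ) :
    (∑ i : Fin 3, pderiv i (pderiv i
      ((∑ j : Fin 3, X j ^ 2) * (∑ j : Fin 3, C (a j) * pderiv j P)
        - C (2 * k + 1 : ℝ) * (∑ j : Fin 3, C (a j) * X j) * P))) = 0 := by
  have hE := hP.sum_X_mul_pderiv
  have hE' : ∀ i, pderiv i P + ∑ j : Fin 3, X j * pderiv j (pderiv i P)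
      = (k : MvPolynomial (Fin 3) ℝ) * pderiv i P := by
    intro i
    have h := congrArg (pderiv i) hE
    simp only [map_sum, Derivation.leibniz, smul_eq_mul, nsmul_eq_mul,
      Derivation.map_natCast, mul_zero, add_zero] at h
    have h1 : ∑ j : Fin 3, pderiv j P * pderiv i (X j) = pderiv i P := by
      simp only [pderiv_X, Pi.single_apply, mul_ite, mul_one, mul_zero]
      simp
    rw [← h, Finset.sum_add_distrib, h1, add_comm]
    refine congrArg (· + pderiv i P) ?_
    exact Finset.sum_congr rfl fun j _ => by rw [aux_pderiv_comm]
  have hD : ∀ i, ∑ j : Fin 3, pderiv j (pderiv j (pderiv i P)) = 0 := by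
    intro i
    have h := congrArg (pderiv i) hΔ
    rw [map_zero, map_sum] at h
    rw [← h]
    exact Finset.sum_congr rfl fun j _ => by
      rw [aux_pderiv_comm j i P, aux_pderiv_comm j i]
  have hk : (C (2 * k + 1 : ℝ) : MvPolynomial (Fin 3) ℝ) = 2 * (k : MvPolynomial (Fin 3) ℝ) + 1 := by
    rw [map_add, map_mul, map_natCast, map_ofNat, map_one]
  rw [hk]
  have e0 := hE' 0
  have e1 := hE' 1
  have e2 := hE' 2
  have d0 := hD 0
  have d1 := hD 1
  have d2 := hD 2
  simp only [Fin.sum_univ_three] at e0 e1 e2 d0 d1 d2 hΔ ⊢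
  simp only [map_sub, map_add, Derivation.leibniz, smul_eq_mul, pderiv_C, pderiv_X, pow_two,
    Pi.single_apply, Derivation.map_natCast, Derivation.map_one_eq_zero,
    map_ofNat, map_zero, map_one]
  have h2 : ∀ i : Fin 3, pderiv i (2 : MvPolynomial (Fin 3) ℝ) = 0 := fun i =>
    (pderiv i).map_natCast 2
  simp only [h2, Fin.isValue, zero_ne_one, one_ne_zero, if_true, if_false, Fin.reduceEq,
    map_zero, mul_zero, mul_one, zero_add, add_zero, smul_zero, Derivation.map_one_eq_zero]
  generalize C (a 0) = a0, C (a 1) = a1, C (a 2) = a2 at *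
  simp only [aux_pderiv_comm 1 0, aux_pderiv_comm 2 0, aux_pderiv_comm 2 1] at *
  linear_combination (4*a0) * e0 + 4*a1*e1 + 4*a2*e2 +
    (X 0^2 + X 1^2+X 2^2) * (a0*d0+a1*d1+a2*d2)
      - (2*(k:MvPolynomial (Fin 3) ℝ)+1) * (a0 * X 0 + a1 * X 1 + a2 * X 2) * hΔ

open MvPolynomial in
theorem aux_homog (k : ℕ) (P : MvPolynomial (Fin 3) ℝ) (hP : P.IsHomogeneous k)
    (a : Fin 3 → ℝ) :
    ((∑ j : Fin 3, X j ^ 2) * (∑ j : Fin 3, C (a j) * pderiv j P)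
        - C (2 * k + 1 : ℝ) * (∑ j : Fin 3, C (a j) * X j) * P).IsHomogeneous (k + 1) := by
  apply IsHomogeneous.sub
  · rcases k with _ | k
    · have h0 : P = C (coeff 0 P) := by
        rwa [← totalDegree_zero_iff_isHomogeneous, totalDegree_eq_zero_iff_eq_C] at hP
      rw [h0]
      simp only [pderiv_C, mul_zero, Finset.sum_const_zero]
      exact isHomogeneous_zero _ _ _
    · have h1 : (∑ j : Fin 3, X j ^ 2 : MvPolynomial (Fin 3) ℝ).IsHomogeneous 2 :=
        IsHomogeneous.sum _ _ _ fun i _ => by simpa using (isHomogeneous_X ℝ i).pow 2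
      have h2 : (∑ j : Fin 3, C (a j) * pderiv j P).IsHomogeneous k :=
        IsHomogeneous.sum _ _ _ fun i _ => (hP.pderiv).C_mul _
      have := h1.mul h2
      rwa [show 2 + k = k + 1 + 1 by ring] at this
  · have h1 : (∑ j : Fin 3, C (a j) * X j : MvPolynomial (Fin 3) ℝ).IsHomogeneous 1 :=
      IsHomogeneous.sum _ _ _ fun i _ => (isHomogeneous_X ℝ i).C_mul _
    have := (h1.C_mul (2 * k + 1 : ℝ)).mul hP
    rwa [add_comm 1 k] at this

open MvPolynomial in
theorem aux_eval (P : MvPolynomial (Fin 3) ℝ) (x : EuclideanSpace ℝ (Fin 3)) :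
    HasFDerivAt (fun x : EuclideanSpace ℝ (Fin 3) => eval (fun i => x i) P)
      (∑ i : Fin 3, eval (fun i => x i) (pderiv i P) •
        (EuclideanSpace.proj i : EuclideanSpace ℝ (Fin 3) →L[ℝ] ℝ)) x := by
  induction P using MvPolynomial.induction_on with
  | C a => simpa using hasFDerivAt_const a x
  | add p q hp hq =>
    simp only [map_add, add_smul, Finset.sum_add_distrib]
    exact hp.add hq
  | mul_X p n hp =>
    have hn : HasFDerivAt (fun x : EuclideanSpace ℝ (Fin 3) => x n)
      (EuclideanSpace.proj n : EuclideanSpace ℝ (Fin 3) →L[ℝ] ℝ) x :=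
      (EuclideanSpace.proj n : EuclideanSpace ℝ (Fin 3) →L[ℝ] ℝ).hasFDerivAt
    have := hp.mul hn
    simp only [map_mul, eval_X]
    refine this.congr_fderiv ?_
    ext u
    fin_cases n <;>
    simp [Fin.sum_univ_three, pderiv_X, Pi.single_apply] <;> ring

theorem aux_norm (x u : EuclideanSpace ℝ (Fin 3)) (hx : x ≠ 0) :
    ∃ d : EuclideanSpace ℝ (Fin 3) →L[ℝ] ℝ, HasFDerivAt (fun x => ‖x‖) d x ∧
      ‖x‖ * d u = ∑ i, u i * x i := by
  have hd : DifferentiableAt ℝ (fun x : EuclideanSpace ℝ (Fin 3) => ‖x‖) x :=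
    differentiableAt_id.norm ℝ hx
  refine ⟨_, hd.hasFDerivAt, ?_⟩
  have h1 := hd.hasFDerivAt.pow 2
  have h2 := (hasStrictFDerivAt_norm_sq x).hasFDerivAt
  have h3 := congrArg (fun D => D u) (h1.unique h2)
  simp [PiLp.inner_apply] at h3
  linarith

open MvPolynomial in
theorem aux_list (l : List (EuclideanSpace ℝ (Fin 3))) :
    ∃ P : MvPolynomial (Fin 3) ℝ,
      P.IsHomogeneous l.length ∧
      (∑ i : Fin 3, pderiv i (pderiv i P)) = 0 ∧
      ∀ x : EuclideanSpace ℝ (Fin 3), x ≠ 0 →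
        l.foldl (fun f u => fun x => fderiv ℝ f x u) (fun x => ‖x‖⁻¹) x
          = eval (fun i => x i) P / ‖x‖ ^ (2 * l.length + 1) := by
  induction l using List.reverseRecOn with
  | nil => exact ⟨1, isHomogeneous_one _ _, by simp, by simp⟩
  | append_singleton l u ih =>
    obtain ⟨P, hP, hΔ, hf⟩ := ih
    refine ⟨_, by simpa using aux_homog _ P hP (fun i => u i),
      by simpa using aux_harm _ P hP hΔ (fun i => u i), ?_⟩
    intro x hx
    simp only [List.foldl_append, List.foldl_cons, List.foldl_nil, List.length_append,
      List.length_singleton]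
    generalize l.length = k at *
    have hev : (l.foldl (fun f u => fun x => fderiv ℝ f x u) (fun x => ‖x‖⁻¹)) =ᶠ[nhds x]
        (fun x => eval (fun i => x i) P / ‖x‖ ^ (2 * k + 1)) := by
      filter_upwards [isOpen_ne.mem_nhds hx] with y hy using hf y hy
    rw [hev.fderiv_eq]
    obtain ⟨d, hd, hdu⟩ := aux_norm x u hx
    have hr : ‖x‖ ≠ 0 := norm_ne_zero_iff.mpr hx
    have hi := (hasDerivAt_inv (pow_ne_zero (2 * k + 1) hr)).comp_hasFDerivAt x
      (hd.pow (2 * k + 1))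
    have hq' := ((aux_eval P x).mul hi).fderiv
    have hn : ‖x‖ ^ 2 = ∑ i, x i ^ 2 := by simp [EuclideanSpace.norm_sq_eq]
    have hdu' : d u = (∑ i, u i * x i) / ‖x‖ := by rw [← hdu]; field_simp
    have hfun : (fun x : EuclideanSpace ℝ (Fin 3) => eval (fun i => x i) P / ‖x‖ ^ (2 * k + 1))
      = (fun x : EuclideanSpace ℝ (Fin 3) => eval (fun i => x i) P) *
        (Inv.inv ∘ ((fun x : EuclideanSpace ℝ (Fin 3) => ‖x‖) ^ (2 * k + 1))) := by
      funext y
      simp [div_eq_mul_inv]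
    rw [hfun]
    erw [hq']
    simp only [map_sub, map_mul, map_sum, eval_C, eval_X, map_pow, ← hn]
    simp [hdu']
    simp only [mul_comm (eval _ (pderiv _ P))]
    generalize (∑ i, u i * x i) = A
    generalize (∑ i, u i * (eval _ (pderiv i P))) = B
    field_simp
    ring

/-- The `n`-th iterated directional derivative of `1/r` along constant vector fields
`v₁, …, vₙ` has the form `P/r^{2n+1}` for a harmonic homogeneous polynomial `P` of
degree `n`. -/
theorem iterDirDeriv_eq_harmonic_div_pow (n : ℕ) (hn : 1 ≤ n)
    (v : Fin n → EuclideanSpace ℝ (Fin 3)) :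
    ∃ P : MvPolynomial (Fin 3) ℝ,
      P ∈ MvPolynomial.homogeneousSubmodule (Fin 3) ℝ n ∧
      (∑ i : Fin 3, MvPolynomial.pderiv i (MvPolynomial.pderiv i P)) = 0 ∧
      ∀ x : EuclideanSpace ℝ (Fin 3), x ≠ 0 →
        iterDirDeriv v x = MvPolynomial.eval (fun i => x i) P / ‖x‖ ^ (2 * n + 1) := by
  obtain ⟨P, h1, h2, h3⟩ := aux_list (List.ofFn v)
  rw [List.length_ofFn] at h1 h3
  exact ⟨P, h1, h2, h3⟩
end

section
/- (Maxwell, existence) Let n ≥ 1 and let ψ be a nonzero harmonic homogeneous polynomial of degree n in three real variables (ψ ∈ MvPolynomial.homogeneousSubmodule (Fin 3) ℝ n, Δψ = 0, ψ ≠ 0). Then there exist nonzero vectors v₁, ..., vₙ ∈ ℝ³ such that the n-th iterated directional derivative of the function x ↦ ‖x‖⁻¹ along v₁, ..., vₙ (defined by f₀(x) = ‖x‖⁻¹ and f_k(x) = (fderiv ℝ f_{k−1} x)(v_k)) coincides with the evaluation of ψ on the unit sphere: for every x ∈ ℝ³ with ‖x‖ = 1, f_n(x) = ψ(x). -/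
open MvPolynomial in
/-- the squared radius -/
noncomputable def mxR2 : MvPolynomial (Fin 3) ℝ := ∑ i : Fin 3, X i ^ 2

open MvPolynomial in
/-- Laplacian -/
noncomputable def mxLap (p : MvPolynomial (Fin 3) ℝ) : MvPolynomial (Fin 3) ℝ :=
  ∑ i : Fin 3, pderiv i (pderiv i p)

open MvPolynomial in
/-- linear form -/
noncomputable def mxLin (v : Fin 3 → ℝ) : MvPolynomial (Fin 3) ℝ := ∑ i : Fin 3, C (v i) * X i

open MvPolynomial in
/-- directional derivative -/
noncomputable def mxD (v : Fin 3 → ℝ) (p : MvPolynomial (Fin 3) ℝ) : MvPolynomial (Fin 3) ℝ :=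
  ∑ i : Fin 3, C (v i) * pderiv i p

namespace MvPolynomial

lemma mxR2_hom : mxR2.IsHomogeneous 2 := by
  unfold mxR2
  exact IsHomogeneous.sum _ _ _ fun i _ => isHomogeneous_X_pow i 2

lemma mxLin_hom (v : Fin 3 → ℝ) : (mxLin v).IsHomogeneous 1 := by
  unfold mxLin
  exact IsHomogeneous.sum _ _ _ fun i _ => isHomogeneous_C_mul_X _ _

lemma mxD_hom (v : Fin 3 → ℝ) {p : MvPolynomial (Fin 3) ℝ} {n : ℕ} (h : p.IsHomogeneous n) :
    (mxD v p).IsHomogeneous (n - 1) := by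
  unfold mxD
  exact IsHomogeneous.sum _ _ _ fun i _ => h.pderiv.C_mul _

lemma mxLap_hom {p : MvPolynomial (Fin 3) ℝ} {n : ℕ} (h : p.IsHomogeneous n) :
    (mxLap p).IsHomogeneous (n - 2) := by
  unfold mxLap
  exact IsHomogeneous.sum _ _ _ fun i _ => h.pderiv.pderiv

lemma mxPderiv_comm (i j : Fin 3) (p : MvPolynomial (Fin 3) ℝ) :
    pderiv i (pderiv j p) = pderiv j (pderiv i p) := by
  have h : ⁅(pderiv i : Derivation ℝ (MvPolynomial (Fin 3) ℝ) (MvPolynomial (Fin 3) ℝ)), (pderiv j : Derivation ℝ (MvPolynomial (Fin 3) ℝ) (MvPolynomial (Fin 3) ℝ))⁆ = 0 := by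
    apply MvPolynomial.derivation_ext
    intro k
    simp only [Derivation.commutator_apply, pderiv_X, Derivation.zero_apply, Pi.single_apply]
    split_ifs <;> simp
  have := congrArg (fun D => D p) h
  simpa [Derivation.commutator_apply, sub_eq_zero] using this

lemma mxEuler {p : MvPolynomial (Fin 3) ℝ} {n : ℕ} (h : p.IsHomogeneous n) :
    X 0 * pderiv 0 p + X 1 * pderiv 1 p + X 2 * pderiv 2 p = C (n : ℝ) * p := by
  have := h.sum_X_mul_pderiv
  rw [Fin.sum_univ_three, nsmul_eq_mul] at this
  simpa using this

lemma mxLap_R2_mul {p : MvPolynomial (Fin 3) ℝ} {n : ℕ} (h : p.IsHomogeneous n) :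
    mxLap (mxR2 * p) = C (6 + 4 * (n : ℝ)) * p + mxR2 * mxLap p := by
  have e := mxEuler h
  simp only [mxLap, mxR2, Fin.sum_univ_three, Derivation.leibniz, Derivation.leibniz_pow, pderiv_X,
    map_add, smul_eq_mul, Pi.single_apply, map_mul, map_natCast, nsmul_eq_mul]
  simp [pderiv_X, Pi.single_apply]
  have e' : C (n : ℝ) = (n : MvPolynomial (Fin 3) ℝ) := by simp
  rw [e'] at e
  have e4 : C (4 : ℝ) = (4 : MvPolynomial (Fin 3) ℝ) := by
    exact map_ofNat C 4
  have e6 : C (6 : ℝ) = (6 : MvPolynomial (Fin 3) ℝ) := by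
    exact map_ofNat C 6
  rw [e4, e6]
  have d2 : ∀ i : Fin 3, pderiv i (2 : MvPolynomial (Fin 3) ℝ) = 0 := fun i => by
    have : (2 : MvPolynomial (Fin 3) ℝ) = C 2 := (map_ofNat C 2).symm
    rw [this, pderiv_C]
  rw [d2, d2, d2]
  linear_combination 4 * e

lemma mxLap_Lin_mul (v : Fin 3 → ℝ) (p : MvPolynomial (Fin 3) ℝ) :
    mxLap (mxLin v * p) = 2 * mxD v p + mxLin v * mxLap p := by
  simp only [mxLap, mxLin, mxD, Fin.sum_univ_three, Derivation.leibniz, pderiv_X, pderiv_C,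
    map_add, smul_eq_mul, Pi.single_apply, map_mul]
  simp [pderiv_X, Pi.single_apply]
  ring

lemma mxLap_D (v : Fin 3 → ℝ) (p : MvPolynomial (Fin 3) ℝ) :
    mxLap (mxD v p) = mxD v (mxLap p) := by
  simp only [mxLap, mxD, Fin.sum_univ_three, pderiv_C_mul, map_add]
  have key : ∀ i j : Fin 3, pderiv i (pderiv i (pderiv j p)) = pderiv j (pderiv i (pderiv i p)) :=
    fun i j => by rw [mxPderiv_comm i j p, mxPderiv_comm i j (pderiv i p)]
  linear_combination C (v 0) * (key 1 0 + key 2 0) + C (v 1) * (key 0 1 + key 2 1)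
    + C (v 2) * (key 0 2 + key 1 2)

lemma mxLap_add (p q : MvPolynomial (Fin 3) ℝ) : mxLap (p + q) = mxLap p + mxLap q := by
  simp [mxLap, Finset.sum_add_distrib]

lemma mxLap_C_mul (c : ℝ) (q : MvPolynomial (Fin 3) ℝ) : mxLap (C c * q) = C c * mxLap q := by
  simp only [mxLap, Finset.smul_sum, C_mul', Derivation.map_smul]

lemma mxLap_R2_pow_mul {p : MvPolynomial (Fin 3) ℝ} {n : ℕ} (h : p.IsHomogeneous n) (j : ℕ) :
    ∃ c : ℝ, 0 < c ∧ mxLap (mxR2 ^ (j + 1) * p) = mxR2 ^ j * (C c * p + mxR2 * mxLap p) := by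
  induction j with
  | zero =>
    refine ⟨6 + 4 * n, by positivity, ?_⟩
    rw [zero_add, pow_one, pow_zero, one_mul]
    exact mxLap_R2_mul h
  | succ j ih =>
    obtain ⟨c, hc, e⟩ := ih
    refine ⟨c + (6 + 4 * ((2 * (j + 1) + n : ℕ) : ℝ)), by positivity, ?_⟩
    have := mxLap_R2_mul ((mxR2_hom.pow (j + 1)).mul h)
    rw [pow_succ' mxR2 (j + 1), mul_assoc, this, e, C_add (a := c)]
    ring

/-- an harmonic homogeneous polynomial divisible by `r²` vanishes -/
lemma mxZero_aux (m : ℕ) : ∀ (q : MvPolynomial (Fin 3) ℝ) (j : ℕ), q.IsHomogeneous m →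
    mxLap (mxR2 ^ (j + 1) * q) = 0 → q = 0 := by
  induction m using Nat.strong_induction_on with
  | _ m ih =>
    intro q j hq h
    obtain ⟨c, hc, e⟩ := mxLap_R2_pow_mul hq j
    have hR : mxR2 ≠ 0 := by
      intro h0
      have := congrArg (eval (fun _ => (1 : ℝ))) h0
      simp [mxR2] at this
    rw [h] at e
    have e2 : C c * q + mxR2 * mxLap q = 0 := by
      rcases mul_eq_zero.1 e.symm with h1 | h1
      · exact absurd h1 (pow_ne_zero _ hR)
      · exact h1
    have e3 : q = mxR2 * (C (-c⁻¹) * mxLap q) := by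
      have : C c⁻¹ * C c = (1 : MvPolynomial (Fin 3) ℝ) := by
        rw [← C_mul, inv_mul_cancel₀ hc.ne', C_1]
      rw [C_neg]
      linear_combination C c⁻¹ * e2 - q * this
    rcases lt_or_ge m 2 with hm | hm
    · have h1 : mxLap q = 0 := by
        have h0 : ∀ i, pderiv i (pderiv i q) = 0 := by
          intro i
          have := (hq.pderiv (i := i))
          have h2 : m - 1 = 0 := by omega
          rw [h2] at this
          rw [← totalDegree_zero_iff_isHomogeneous, totalDegree_eq_zero_iff_eq_C] at this
          rw [this, pderiv_C]
        simp [mxLap, h0]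
      rw [e3, h1]; simp
    · have := ih (m - 2) (by omega) (C (-c⁻¹) * mxLap q) (j + 1) ((mxLap_hom hq).C_mul _)
        (by rw [pow_succ, mul_assoc, ← e3]; exact h)
      rw [e3, this, mul_zero]

attribute [local instance] MvPolynomial.gradedAlgebra in
lemma mxComp_mul {a : MvPolynomial (Fin 3) ℝ} {i : ℕ} (ha : a.IsHomogeneous i)
    (b : MvPolynomial (Fin 3) ℝ) (j : ℕ) :
    homogeneousComponent (i + j) (a * b) = a * homogeneousComponent j b := by
  have := DirectSum.coe_decompose_mul_add_of_left_mem (homogeneousSubmodule (Fin 3) ℝ)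
    (i := i) (j := j) (a := a) (b := b) ha
  have h2 : ∀ (p : MvPolynomial (Fin 3) ℝ) (k : ℕ),
    (DirectSum.decompose (homogeneousSubmodule (Fin 3) ℝ) p k : MvPolynomial (Fin 3) ℝ)
      = homogeneousComponent k p := fun p k => decomposition.decompose'_apply p k
  rwa [h2, h2] at this

attribute [local instance] MvPolynomial.gradedAlgebra in
lemma mxComp_mul_lt {a : MvPolynomial (Fin 3) ℝ} {i : ℕ} (ha : a.IsHomogeneous i)
    (b : MvPolynomial (Fin 3) ℝ) (n : ℕ) (hn : n < i) :
    homogeneousComponent n (a * b) = 0 := by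
  have := DirectSum.coe_decompose_mul_of_left_mem_of_not_le (homogeneousSubmodule (Fin 3) ℝ)
    (i := i) (n := n) (a := a) (b := b) ha (by omega)
  have h2 : ∀ (p : MvPolynomial (Fin 3) ℝ) (k : ℕ),
    (DirectSum.decompose (homogeneousSubmodule (Fin 3) ℝ) p k : MvPolynomial (Fin 3) ℝ)
      = homogeneousComponent k p := fun p k => decomposition.decompose'_apply p k
  rwa [h2] at this

lemma mxZero {p : MvPolynomial (Fin 3) ℝ} {n : ℕ} (hp : p.IsHomogeneous n) (hL : mxLap p = 0)
    (hd : mxR2 ∣ p) : p = 0 := by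
  obtain ⟨q, rfl⟩ := hd
  have h0 := homogeneousComponent_eq_self hp
  rcases lt_or_ge n 2 with hn | hn
  · rw [← h0]; exact mxComp_mul_lt mxR2_hom q n hn
  · obtain ⟨m, rfl⟩ := Nat.exists_eq_add_of_le hn
    rw [mxComp_mul mxR2_hom] at h0
    rw [← h0] at hL ⊢
    rw [mxZero_aux m (homogeneousComponent m q) 0 (homogeneousComponent_isHomogeneous _ _)
      (by simpa using hL), mul_zero]

/-- one step of the recursion for the numerators -/
lemma mxStep_harm (v : Fin 3 → ℝ) {p : MvPolynomial (Fin 3) ℝ} {k : ℕ} (hp : p.IsHomogeneous k)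
    (hL : mxLap p = 0) :
    (mxR2 * mxD v p + C (-(2 * (k : ℝ) + 1)) * (mxLin v * p)).IsHomogeneous (k + 1) ∧
    mxLap (mxR2 * mxD v p + C (-(2 * (k : ℝ) + 1)) * (mxLin v * p)) = 0 := by
  have hlin : (C (-(2 * (k : ℝ) + 1)) * (mxLin v * p)).IsHomogeneous (k + 1) := by
    have := ((mxLin_hom v).mul hp).C_mul (-(2 * (k : ℝ) + 1))
    rwa [add_comm 1 k] at this
  rw [mxLap_add, mxLap_C_mul, mxLap_Lin_mul, mxLap_R2_mul (mxD_hom v hp), mxLap_D, hL]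
  have hD0 : mxD v 0 = 0 := by simp [mxD]
  rw [hD0]
  rcases Nat.eq_zero_or_pos k with rfl | hk
  · have hD : mxD v p = 0 := by
      rw [← totalDegree_zero_iff_isHomogeneous, totalDegree_eq_zero_iff_eq_C] at hp
      rw [hp]; simp [mxD]
    rw [hD]
    refine ⟨?_, by simp⟩
    simpa using hlin
  · obtain ⟨m, rfl⟩ := Nat.exists_eq_add_of_le hk
    constructor
    · refine IsHomogeneous.add ?_ hlin
      have := mxR2_hom.mul (mxD_hom v hp)
      convert this using 1
      omega
    · have e2 : C (2 : ℝ) = (2 : MvPolynomial (Fin 3) ℝ) := by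
        exact map_ofNat C 2
      rw [← e2]
      simp only [add_tsub_cancel_left, mul_zero, add_zero]
      rw [← mul_assoc, ← C_mul, ← add_mul, ← C_add]
      push_cast
      ring_nf
      simp

end MvPolynomial

namespace MvPolynomial

lemma mxAeval_smul {ψ : MvPolynomial (Fin 3) ℝ} {n : ℕ} (h : ψ.IsHomogeneous n) (c : ℂ)
    (P : Fin 3 → ℂ) : aeval (fun i => c * P i) ψ = c ^ n * aeval P ψ := by
  rw [aeval_def, aeval_def, eval₂_eq', eval₂_eq', Finset.mul_sum]
  refine Finset.sum_congr rfl fun d hd => ?_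
  have : d.degree = n := by
    by_contra hne
    exact (mem_support_iff.1 hd) (h.coeff_eq_zero hne)
  have h2 : ∑ i, d i = n := by rw [← this, Finsupp.degree_eq_sum]
  simp only [mul_pow, Finset.prod_mul_distrib, Finset.prod_pow_eq_pow_sum, h2]
  ring

/-- polynomial curve: either a root or constant -/
lemma mxCurve (ψ : MvPolynomial (Fin 3) ℝ) (p : Fin 3 → Polynomial ℂ) :
    (∃ t, aeval (fun i => (p i).eval t) ψ = 0) ∨
      ∃ c, ∀ t, aeval (fun i => (p i).eval t) ψ = c := by
  have key : ∀ t, aeval (fun i => (p i).eval t) ψ = (aeval p ψ).eval t := by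
    intro t
    have := MvPolynomial.comp_aeval_apply (R := ℝ) p
      ((Polynomial.aeval (R := ℂ) (A := ℂ) t).restrictScalars ℝ) ψ
    simpa [Polynomial.coe_aeval_eq_eval] using this.symm
  by_cases hd : (aeval p ψ).degree = 0
  · right
    rw [Polynomial.eq_C_of_degree_eq_zero hd] at key
    exact ⟨_, fun t => by rw [key, Polynomial.eval_C]⟩
  · left
    obtain ⟨t, ht⟩ := IsAlgClosed.exists_root _ hd
    exact ⟨t, by rw [key]; exact ht⟩

lemma mxIsotropic {ψ : MvPolynomial (Fin 3) ℝ} {n : ℕ} (hn : 1 ≤ n) (h : ψ.IsHomogeneous n) :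
    ∃ P : Fin 3 → ℂ, P ≠ 0 ∧ P 0 ^ 2 + P 1 ^ 2 + P 2 ^ 2 = 0 ∧ aeval P ψ = 0 := by
  have gF : ∀ t : ℂ, aeval (![1 - t ^ 2, Complex.I * (1 + t ^ 2), 2 * t]) ψ = 0 →
      ∃ P : Fin 3 → ℂ, P ≠ 0 ∧ P 0 ^ 2 + P 1 ^ 2 + P 2 ^ 2 = 0 ∧ aeval P ψ = 0 := by
    intro t ht
    refine ⟨_, ?_, ?_, ht⟩
    · intro h0
      have h1 := congrFun h0 0
      have h2 := congrFun h0 1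
      simp at h1 h2
      have : (2 : ℂ) = 0 := by linear_combination h1 + h2
      norm_num at this
    · simp
      linear_combination (1 + t ^ 2) ^ 2 * Complex.I_sq
  have gG : ∀ t : ℂ, aeval (![t ^ 2 - 1, Complex.I * (1 + t ^ 2), 2 * t]) ψ = 0 →
      ∃ P : Fin 3 → ℂ, P ≠ 0 ∧ P 0 ^ 2 + P 1 ^ 2 + P 2 ^ 2 = 0 ∧ aeval P ψ = 0 := by
    intro t ht
    refine ⟨_, ?_, ?_, ht⟩
    · intro h0
      have h1 := congrFun h0 0
      have h2 := congrFun h0 1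
      simp at h1 h2
      have : (2 : ℂ) = 0 := by linear_combination h2 - h1
      norm_num at this
    · simp
      linear_combination (1 + t ^ 2) ^ 2 * Complex.I_sq
  have eF : ∀ t : ℂ, (fun i => Polynomial.eval t ((![1 - Polynomial.X ^ 2,
      Polynomial.C Complex.I * (1 + Polynomial.X ^ 2), 2 * Polynomial.X] : Fin 3 → Polynomial ℂ) i))
      = ![1 - t ^ 2, Complex.I * (1 + t ^ 2), 2 * t] := by
    intro t; funext i; fin_cases i <;> simp
  have eG : ∀ t : ℂ, (fun i => Polynomial.eval t ((![Polynomial.X ^ 2 - 1,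
      Polynomial.C Complex.I * (1 + Polynomial.X ^ 2), 2 * Polynomial.X] : Fin 3 → Polynomial ℂ) i))
      = ![t ^ 2 - 1, Complex.I * (1 + t ^ 2), 2 * t] := by
    intro t; funext i; fin_cases i <;> simp
  rcases mxCurve ψ ![1 - Polynomial.X ^ 2,
      Polynomial.C Complex.I * (1 + Polynomial.X ^ 2), 2 * Polynomial.X] with ⟨t, ht⟩ | ⟨f, hf⟩
  · rw [eF] at ht; exact gF t ht
  rcases mxCurve ψ ![Polynomial.X ^ 2 - 1,
      Polynomial.C Complex.I * (1 + Polynomial.X ^ 2), 2 * Polynomial.X] with ⟨t, ht⟩ | ⟨g, hg⟩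
  · rw [eG] at ht; exact gG t ht
  simp only [eF] at hf
  simp only [eG] at hg
  have h1 : f = g := by
    rw [← hf 1, ← hg 1]; simp
  have h2 : g = 4 ^ n * f := by
    rw [← hf (1 / 2), ← hg 2, ← mxAeval_smul h]
    congr 2
    funext i; fin_cases i <;> simp <;> ring
  have h4 : (4 : ℂ) ^ n ≠ 1 := by
    have : (4 : ℕ) ^ n ≠ 1 := (Nat.one_lt_pow (by omega) (by norm_num)).ne'
    exact_mod_cast this
  have h5 : f = 0 := by
    have : ((4 : ℂ) ^ n - 1) * f = 0 := by linear_combination -h2 - h1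
    rcases mul_eq_zero.1 this with h | h
    · exact absurd (sub_eq_zero.1 h) h4
    · exact h
  exact gF 0 (by rw [hf, h5])

lemma mxReduce {a b v : Fin 3 → ℝ} {s : ℝ}
    (hX : ∀ i, X i = C (a i / s) * mxLin a + C (b i / s) * mxLin b + mxLin v * C (v i / s ^ 2))
    (hB : mxLin b ^ 2 = - mxLin a ^ 2 + C s * mxR2 - C (1 / s) * mxLin v ^ 2) (k : ℕ) :
    ∀ ψ : MvPolynomial (Fin 3) ℝ, ψ.IsHomogeneous (k + 1) → ∃ α β : ℝ, ∃ q₁ q₂,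
      ψ = C α * mxLin a ^ (k + 1) + C β * (mxLin a ^ k * mxLin b) + mxLin v * q₁ + mxR2 * q₂ := by
  have base : ∀ ψ : MvPolynomial (Fin 3) ℝ, ψ ∈ homogeneousSubmodule (Fin 3) ℝ 1 →
      ∃ α β : ℝ, ∃ q₁ q₂,
      ψ = C α * mxLin a + C β * mxLin b + mxLin v * q₁ + mxR2 * q₂ := by
    intro ψ h
    rw [homogeneousSubmodule_one_eq_span_X] at h
    induction h using Submodule.span_induction with
    | mem x hx =>
      obtain ⟨i, rfl⟩ := hx
      exact ⟨_, _, C (v i / s ^ 2), 0, by rw [mul_zero, add_zero]; exact hX i⟩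
    | zero => exact ⟨0, 0, 0, 0, by simp⟩
    | add x y _ _ hx hy =>
      obtain ⟨α, β, q, r, rfl⟩ := hx
      obtain ⟨α', β', q', r', rfl⟩ := hy
      exact ⟨α + α', β + β', q + q', r + r', by simp only [C_add]; ring⟩
    | smul c x _ hx =>
      obtain ⟨α, β, q, r, rfl⟩ := hx
      exact ⟨c * α, c * β, C c * q, C c * r, by rw [← C_mul']; simp only [C_mul]; ring⟩
  induction k with
  | zero =>
    intro ψ h
    simpa using base ψ h
  | succ k ih =>
    intro ψ h
    have h' : ψ ∈ homogeneousSubmodule (Fin 3) ℝ 1 * homogeneousSubmodule (Fin 3) ℝ (k + 1) := by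
      have : ψ ∈ homogeneousSubmodule (Fin 3) ℝ (k + 1 + 1) := h
      rw [← homogeneousSubmodule_one_pow, pow_succ', homogeneousSubmodule_one_pow] at this
      exact this
    refine Submodule.mul_induction_on h' ?_ ?_
    · intro m hm n hn
      obtain ⟨α, β, q, r, e⟩ := base m hm
      obtain ⟨α', β', q', r', e'⟩ := ih n hn
      refine ⟨α * α' - β * β', α * β' + β * α',
        (q * n + (C α * mxLin a + C β * mxLin b) * q' - C β * C β' * mxLin a ^ k * C (1 / s) * mxLin v),
        (r * n + (C α * mxLin a + C β * mxLin b) * r' + C β * C β' * mxLin a ^ k * C s), ?_⟩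
      simp only [C_add, C_sub, C_mul]
      rw [e]
      linear_combination (C α * mxLin a + C β * mxLin b) * e' + C β * C β' * mxLin a ^ k * hB
    · rintro x y ⟨α, β, q, r, rfl⟩ ⟨α', β', q', r', rfl⟩
      exact ⟨α + α', β + β', q + q', r + r', by simp only [C_add]; ring⟩

lemma mxSylvester_step {ψ : MvPolynomial (Fin 3) ℝ} {k : ℕ} (h : ψ.IsHomogeneous (k + 1)) :
    ∃ v : Fin 3 → ℝ, v ≠ 0 ∧ ∃ ψ' : MvPolynomial (Fin 3) ℝ, ψ'.IsHomogeneous k ∧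
      mxR2 ∣ ψ - mxLin v * ψ' := by
  obtain ⟨P, hP0, hP, hψ⟩ := mxIsotropic (by omega) h
  obtain ⟨a, ha⟩ : ∃ a : Fin 3 → ℝ, ∀ i, a i = (P i).re := ⟨fun i => (P i).re, fun _ => rfl⟩
  obtain ⟨b, hb⟩ : ∃ b : Fin 3 → ℝ, ∀ i, b i = (P i).im := ⟨fun i => (P i).im, fun _ => rfl⟩
  have hPab : ∀ i, P i = (a i : ℂ) + (b i : ℂ) * Complex.I := fun i => by
    rw [ha, hb, Complex.re_add_im]
  obtain ⟨s, hs⟩ : ∃ s, s = a 0 ^ 2 + a 1 ^ 2 + a 2 ^ 2 := ⟨_, rfl⟩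
  have hre := congrArg Complex.re hP
  have him := congrArg Complex.im hP
  simp [pow_two, ← ha, ← hb] at hre him
  have hsb : s = b 0 ^ 2 + b 1 ^ 2 + b 2 ^ 2 := by linear_combination hs + hre
  have hab : a 0 * b 0 + a 1 * b 1 + a 2 * b 2 = 0 := by linear_combination him / 2
  have hspos : 0 < s := by
    rcases (show 0 ≤ s by rw [hs]; positivity).lt_or_eq with h1 | h1
    · exact h1
    · exfalso
      apply hP0
      funext i
      have a0 : a i = 0 := by
        have : a i ^ 2 = 0 := by
          fin_cases i <;> simp <;> nlinarith [sq_nonneg (a 0), sq_nonneg (a 1), sq_nonneg (a 2)]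
        simpa using this
      have b0 : b i = 0 := by
        have : b i ^ 2 = 0 := by
          fin_cases i <;> simp <;> nlinarith [sq_nonneg (b 0), sq_nonneg (b 1), sq_nonneg (b 2)]
        simpa using this
      rw [hPab, a0, b0]; simp
  obtain ⟨v, hv0, hv1, hv2⟩ : ∃ v : Fin 3 → ℝ, v 0 = a 1 * b 2 - a 2 * b 1 ∧
      v 1 = a 2 * b 0 - a 0 * b 2 ∧ v 2 = a 0 * b 1 - a 1 * b 0 :=
    ⟨![a 1 * b 2 - a 2 * b 1, a 2 * b 0 - a 0 * b 2, a 0 * b 1 - a 1 * b 0], rfl, rfl, rfl⟩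
  have d00 : s * (a 0 * a 0 + b 0 * b 0) + v 0 * v 0 = s ^ 2 := by rw [hv0]; grind
  have d11 : s * (a 1 * a 1 + b 1 * b 1) + v 1 * v 1 = s ^ 2 := by rw [hv1]; grind
  have d22 : s * (a 2 * a 2 + b 2 * b 2) + v 2 * v 2 = s ^ 2 := by rw [hv2]; grind
  have d01 : s * (a 0 * a 1 + b 0 * b 1) + v 0 * v 1 = 0 := by rw [hv0, hv1]; grind
  have d02 : s * (a 0 * a 2 + b 0 * b 2) + v 0 * v 2 = 0 := by rw [hv0, hv2]; grind
  have d12 : s * (a 1 * a 2 + b 1 * b 2) + v 1 * v 2 = 0 := by rw [hv1, hv2]; grind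
  have hX2 : ∀ i, C (s ^ 2) * X i = C s * (C (a i) * mxLin a + C (b i) * mxLin b)
      + mxLin v * C (v i) := by
    have c00 := congrArg (C (σ := Fin 3)) d00
    have c11 := congrArg (C (σ := Fin 3)) d11
    have c22 := congrArg (C (σ := Fin 3)) d22
    have c01 := congrArg (C (σ := Fin 3)) d01
    have c02 := congrArg (C (σ := Fin 3)) d02
    have c12 := congrArg (C (σ := Fin 3)) d12
    simp only [C_add, C_mul, C_0] at c00 c11 c22 c01 c02 c12
    intro i
    simp only [mxLin, Fin.sum_univ_three]
    fin_cases i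
    · simp only [Fin.zero_eta]
      linear_combination -X 0 * c00 - X 1 * c01 - X 2 * c02
    · simp only [Fin.mk_one]
      linear_combination -X 0 * c01 - X 1 * c11 - X 2 * c12
    · simp only [Fin.reduceFinMk]
      linear_combination -X 0 * c02 - X 1 * c12 - X 2 * c22
  have hinv : C (1 / s) * C s = (1 : MvPolynomial (Fin 3) ℝ) := by
    rw [← C_mul, one_div_mul_cancel hspos.ne', C_1]
  have hX : ∀ i, X i = C (a i / s) * mxLin a + C (b i / s) * mxLin b
      + mxLin v * C (v i / s ^ 2) := by
    intro i
    have e1 : C (σ := Fin 3) (a i / s) = C (a i) * C (1 / s) := by rw [← C_mul]; ring_nf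
    have e2 : C (σ := Fin 3) (b i / s) = C (b i) * C (1 / s) := by rw [← C_mul]; ring_nf
    have e3 : C (σ := Fin 3) (v i / s ^ 2) = C (v i) * C (1 / s) ^ 2 := by rw [← C_pow, ← C_mul]; ring_nf
    rw [e1, e2, e3]
    have := hX2 i
    rw [C_pow] at this
    linear_combination C (1 / s) ^ 2 * this - (X i * (C (1 / s) * C s + 1) -
      C (1 / s) * (C (a i) * mxLin a + C (b i) * mxLin b)) * hinv
  have hB : mxLin b ^ 2 = - mxLin a ^ 2 + C s * mxR2 - C (1 / s) * mxLin v ^ 2 := by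
    have e : C (s ^ 2) * mxR2 = C s * (mxLin a ^ 2 + mxLin b ^ 2) + mxLin v ^ 2 := by
      have h0 := hX2 0
      have h1 := hX2 1
      have h2 := hX2 2
      have ea : mxLin a = C (a 0) * X 0 + C (a 1) * X 1 + C (a 2) * X 2 := by
        simp [mxLin, Fin.sum_univ_three]
      have eb : mxLin b = C (b 0) * X 0 + C (b 1) * X 1 + C (b 2) * X 2 := by
        simp [mxLin, Fin.sum_univ_three]
      have ev : mxLin v = C (v 0) * X 0 + C (v 1) * X 1 + C (v 2) * X 2 := by
        simp [mxLin, Fin.sum_univ_three]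
      have er : mxR2 = X 0 ^ 2 + X 1 ^ 2 + X 2 ^ 2 := by
        simp [mxR2, Fin.sum_univ_three]
      rw [er]
      linear_combination X 0 * h0 + X 1 * h1 + X 2 * h2 - C s * mxLin a * ea - C s * mxLin b * eb
        - mxLin v * ev
    rw [C_pow] at e
    linear_combination (-C (1 / s)) * e + (C s * mxR2 - mxLin a ^ 2 - mxLin b ^ 2) * hinv
  obtain ⟨α, β, q₁, q₂, e⟩ := mxReduce hX hB k ψ h
  have hVP : aeval P (mxLin v) = 0 := by
    simp only [mxLin, Fin.sum_univ_three, map_add, map_mul, aeval_X, aeval_C, hPab,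
      Complex.coe_algebraMap, hv0, hv1, hv2]
    push_cast
    ring
  have hRP : aeval P mxR2 = 0 := by
    simp only [mxR2, Fin.sum_univ_three, map_add, map_pow, aeval_X]
    exact hP
  have cs : (s : ℂ) = a 0 ^ 2 + a 1 ^ 2 + a 2 ^ 2 := by exact_mod_cast hs
  have csb : (s : ℂ) = b 0 ^ 2 + b 1 ^ 2 + b 2 ^ 2 := by exact_mod_cast hsb
  have cab : (a 0 * b 0 + a 1 * b 1 + a 2 * b 2 : ℂ) = 0 := by exact_mod_cast hab
  have hAP : aeval P (mxLin a) = (s : ℂ) := by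
    simp only [mxLin, Fin.sum_univ_three, map_add, map_mul, aeval_X, aeval_C, hPab,
      Complex.coe_algebraMap]
    linear_combination -cs + Complex.I * cab
  have hBP : aeval P (mxLin b) = (s : ℂ) * Complex.I := by
    simp only [mxLin, Fin.sum_univ_three, map_add, map_mul, aeval_X, aeval_C, hPab,
      Complex.coe_algebraMap]
    linear_combination -Complex.I * csb + cab
  have hs0 : (s : ℂ) ≠ 0 := by exact_mod_cast hspos.ne'
  have hev : (s : ℂ) ^ (k + 1) * (α + β * Complex.I) = 0 := by
    have := congrArg (aeval P) e
    simp only [map_add, map_mul, map_pow, aeval_C, hVP, hRP, hAP, hBP, hψ,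
      Complex.coe_algebraMap] at this
    linear_combination -this
  have h0 : (α : ℂ) + β * Complex.I = 0 := by
    rcases mul_eq_zero.1 hev with h | h
    · exact absurd h (pow_ne_zero _ hs0)
    · exact h
  have hα : α = 0 := by simpa using congrArg Complex.re h0
  have hβ : β = 0 := by simpa using congrArg Complex.im h0
  rw [hα, hβ] at e
  simp only [C_0, zero_mul, zero_add] at e
  refine ⟨v, ?_, homogeneousComponent k q₁, homogeneousComponent_isHomogeneous _ _, ?_⟩
  · rintro rfl
    have : s ^ 2 * 2 = s ^ 2 * 3 := by
      simp only [Pi.zero_apply] at d00 d11 d22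
      linear_combination d00 + d11 + d22 + s * hs + s * hsb
    have : s ^ 2 = 0 := by linarith
    exact hspos.ne' (by simpa using this)
  · have h1 := homogeneousComponent_eq_self h
    have h2 := mxComp_mul (mxLin_hom v) q₁ k
    rw [add_comm 1 k] at h2
    have h3 : ψ - mxLin v * homogeneousComponent k q₁ = homogeneousComponent (k + 1) (mxR2 * q₂) := by
      rw [← h2]
      conv_lhs => rw [← h1, e, map_add]
      ring
    rw [h3]
    rcases lt_or_ge (k + 1) 2 with hk | hk
    · rw [mxComp_mul_lt mxR2_hom _ _ hk]; exact dvd_zero _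
    · obtain ⟨m, hm⟩ := Nat.exists_eq_add_of_le hk
      rw [hm, mxComp_mul mxR2_hom]
      exact dvd_mul_right _ _

lemma mxSylvester (n : ℕ) : ∀ ψ : MvPolynomial (Fin 3) ℝ, ψ.IsHomogeneous n →
    ∃ l : List (Fin 3 → ℝ), l.length = n ∧ (∀ v ∈ l, v ≠ 0) ∧ ∃ c : ℝ,
      mxR2 ∣ ψ - C c * (l.map mxLin).prod := by
  induction n with
  | zero =>
    intro ψ h
    rw [← totalDegree_zero_iff_isHomogeneous, totalDegree_eq_zero_iff_eq_C] at h
    exact ⟨[], rfl, by simp, coeff 0 ψ, by simp [← h]⟩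
  | succ n ih =>
    intro ψ h
    obtain ⟨v, hv, ψ', h', r, hr⟩ := mxSylvester_step h
    obtain ⟨l, hl, hl0, c, r', hr'⟩ := ih ψ' h'
    refine ⟨v :: l, by simp [hl], by simpa [hv] using hl0, c, r + mxLin v * r', ?_⟩
    rw [List.map_cons, List.prod_cons]
    linear_combination hr + mxLin v * hr'

end MvPolynomial

namespace MvPolynomial

lemma mxHasFDeriv (p : MvPolynomial (Fin 3) ℝ) (x : EuclideanSpace ℝ (Fin 3)) :
    ∃ L : EuclideanSpace ℝ (Fin 3) →L[ℝ] ℝ,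
      HasFDerivAt (fun y : EuclideanSpace ℝ (Fin 3) => eval (fun i => y i) p) L x ∧
      ∀ v : EuclideanSpace ℝ (Fin 3), L v = eval (fun i => x i) (mxD (fun i => v i) p) := by
  induction p using MvPolynomial.induction_on with
  | C a =>
    refine ⟨0, ?_, ?_⟩
    · simpa using hasFDerivAt_const a x
    · intro v; simp [mxD]
  | add p q hp hq =>
    obtain ⟨L, h, e⟩ := hp
    obtain ⟨L', h', e'⟩ := hq
    refine ⟨L + L', ?_, ?_⟩
    · simp only [map_add]
      exact h.add h'
    · intro v
      rw [_root_.add_apply, e, e']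
      simp only [mxD, Fin.sum_univ_three, map_add, map_mul]
      ring
  | mul_X p i hp =>
    obtain ⟨L, h, e⟩ := hp
    have hX : HasFDerivAt (fun y : EuclideanSpace ℝ (Fin 3) => y i)
      (EuclideanSpace.proj i : EuclideanSpace ℝ (Fin 3) →L[ℝ] ℝ) x :=
      (EuclideanSpace.proj i : EuclideanSpace ℝ (Fin 3) →L[ℝ] ℝ).hasFDerivAt
    refine ⟨eval (fun i => x i) p • (EuclideanSpace.proj i : EuclideanSpace ℝ (Fin 3) →L[ℝ] ℝ)
      + x i • L, ?_, ?_⟩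
    · simp only [map_mul, eval_X]
      exact h.mul hX
    · intro v
      simp only [_root_.add_apply, _root_.smul_apply, e, smul_eq_mul,
        PiLp.proj_apply]
      simp only [mxD, Fin.sum_univ_three, map_add, map_mul, Derivation.leibniz, smul_eq_mul,
        pderiv_X, Pi.single_apply]
      fin_cases i <;> simp <;> ring

lemma mxHasFDeriv_norm {x : EuclideanSpace ℝ (Fin 3)} (hx : x ≠ 0) :
    ∃ L : EuclideanSpace ℝ (Fin 3) →L[ℝ] ℝ,
      HasFDerivAt (fun y : EuclideanSpace ℝ (Fin 3) => ‖y‖) L x ∧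
      ∀ v : EuclideanSpace ℝ (Fin 3), ‖x‖ * L v = eval (fun i => x i) (mxLin (fun i => v i)) := by
  have hd : DifferentiableAt ℝ (fun y : EuclideanSpace ℝ (Fin 3) => ‖y‖) x :=
    DifferentiableAt.norm ℝ differentiableAt_id hx
  refine ⟨_, hd.hasFDerivAt, fun v => ?_⟩
  have h1 := hd.hasFDerivAt.pow 2
  have h2 := (hasFDerivAt_id x).norm_sq
  have h3 := congrArg (fun L => L v) (h1.unique h2)
  simp [PiLp.inner_apply, Fin.sum_univ_three] at h3
  simp [mxLin, Fin.sum_univ_three]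
  linarith

lemma mxR2_eval (x : EuclideanSpace ℝ (Fin 3)) : eval (fun i => x i) mxR2 = ‖x‖ ^ 2 := by
  rw [EuclideanSpace.real_norm_sq_eq]; simp [mxR2]

lemma mxDeriv_step (k : ℕ) (H : MvPolynomial (Fin 3) ℝ) (f : EuclideanSpace ℝ (Fin 3) → ℝ)
    (hf : ∀ x, x ≠ 0 → f x = eval (fun i => x i) H * (‖x‖ ^ (2 * k + 1))⁻¹)
    (v x : EuclideanSpace ℝ (Fin 3)) (hx : x ≠ 0) :
    fderiv ℝ f x v = eval (fun i => x i)
      (mxR2 * mxD (fun i => v i) H + C (-(2 * (k : ℝ) + 1)) * (mxLin (fun i => v i) * H)) *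
      (‖x‖ ^ (2 * (k + 1) + 1))⁻¹ := by
  obtain ⟨L, h, e⟩ := mxHasFDeriv H x
  obtain ⟨N, hN, eN⟩ := mxHasFDeriv_norm hx
  have hn : ‖x‖ ≠ 0 := norm_ne_zero_iff.2 hx
  have hn2 : ‖x‖ ^ (2 * k + 1) ≠ 0 := pow_ne_zero _ hn
  have h1 := (hasDerivAt_inv hn2).comp_hasFDerivAt x (hN.pow (2 * k + 1))
  have h2 := h.mul h1
  have heq : f =ᶠ[nhds x] fun y => eval (fun i => y i) H * (‖y‖ ^ (2 * k + 1))⁻¹ := by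
    filter_upwards [isOpen_ne.mem_nhds hx] with y hy using hf y hy
  have h3 := h2.congr_of_eventuallyEq heq
  rw [h3.fderiv]
  have eN' : N v = eval (fun i => x i) (mxLin (fun i => v i)) / ‖x‖ := by
    rw [← eN v]; field_simp
  simp only [_root_.add_apply, _root_.smul_apply, e, smul_eq_mul, eN',
    map_add, map_mul, mxR2_eval, eval_C, Function.comp]
  simp
  field_simp
  ring

lemma mxFold (n : ℕ) : ∀ k : ℕ, ∃ c : ℝ, c ≠ 0 ∧ ∀ l : List (EuclideanSpace ℝ (Fin 3)),
    l.length = n → ∀ (H : MvPolynomial (Fin 3) ℝ) (f : EuclideanSpace ℝ (Fin 3) → ℝ),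
    H.IsHomogeneous k → mxLap H = 0 →
    (∀ x, x ≠ 0 → f x = eval (fun i => x i) H * (‖x‖ ^ (2 * k + 1))⁻¹) →
    ∃ H' : MvPolynomial (Fin 3) ℝ, H'.IsHomogeneous (k + n) ∧ mxLap H' = 0 ∧
      mxR2 ∣ H' - C c * ((l.map (fun v => mxLin (fun i => v i))).prod * H) ∧
      ∀ x, x ≠ 0 → l.foldl (fun f u => fun x => fderiv ℝ f x u) f x
        = eval (fun i => x i) H' * (‖x‖ ^ (2 * (k + n) + 1))⁻¹ := by
  induction n with
  | zero =>
    intro k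
    refine ⟨1, one_ne_zero, fun l hl H f hH hL hf => ⟨H, hH, hL, ?_, ?_⟩⟩
    · rw [List.length_eq_zero_iff] at hl; simp [hl]
    · rw [List.length_eq_zero_iff] at hl; simpa [hl] using hf
  | succ n ih =>
    intro k
    obtain ⟨c, hc, h⟩ := ih (k + 1)
    refine ⟨c * (-(2 * (k : ℝ) + 1)), mul_ne_zero hc (neg_ne_zero.2 (by positivity)), ?_⟩
    intro l hl H f hH hL hf
    obtain ⟨v, l, rfl⟩ := List.exists_cons_of_length_eq_add_one hl
    obtain ⟨s1, s2⟩ := mxStep_harm (fun i => v i) hH hL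
    obtain ⟨H', a1, a2, ⟨r, hr⟩, a4⟩ := h l (by simpa using hl) _ (fun x => fderiv ℝ f x v) s1 s2
      (fun x hx => mxDeriv_step k H f hf v x hx)
    have hkn : k + 1 + n = k + (n + 1) := by ring
    rw [hkn] at a1 a4
    refine ⟨H', a1, a2, ⟨r + C c * (l.map (fun v => mxLin (fun i => v i))).prod *
      mxD (fun i => v i) H, ?_⟩, a4⟩
    rw [List.map_cons, List.prod_cons, C_mul]
    linear_combination hr

end MvPolynomial

/-- Maxwell's multipole representation of spherical functions (existence): every
nonzero harmonic homogeneous polynomial `ψ` of degree `n ≥ 1` coincides on the unit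
sphere with the `n`-th iterated directional derivative of `1/r` along some `n`-tuple
of nonzero constant vector fields. -/
theorem maxwell_multipole_exists (n : ℕ) (hn : 1 ≤ n) (ψ : MvPolynomial (Fin 3) ℝ)
    (hhom : ψ ∈ MvPolynomial.homogeneousSubmodule (Fin 3) ℝ n)
    (hharm : (∑ i : Fin 3, MvPolynomial.pderiv i (MvPolynomial.pderiv i ψ)) = 0)
    (hne : ψ ≠ 0) :
    ∃ v : Fin n → EuclideanSpace ℝ (Fin 3), (∀ i, v i ≠ 0) ∧
      ∀ x : EuclideanSpace ℝ (Fin 3), ‖x‖ = 1 →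
        iterDirDeriv v x = MvPolynomial.eval (fun i => x i) ψ := by
  have hψ : ψ.IsHomogeneous n := hhom
  have hLψ : mxLap ψ = 0 := hharm
  obtain ⟨c₀, hc₀, hF⟩ := MvPolynomial.mxFold n 0
  obtain ⟨l, hl, hl0, c, hd⟩ := MvPolynomial.mxSylvester n ψ hψ
  have hc : c ≠ 0 := by
    rintro rfl
    refine hne (MvPolynomial.mxZero hψ hLψ ?_)
    simpa using hd
  obtain ⟨m, rfl⟩ := Nat.exists_eq_add_of_le' hn
  obtain ⟨w, l, rfl⟩ := List.exists_cons_of_length_eq_add_one hl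
  obtain ⟨L, hLdef⟩ : ∃ L : List (EuclideanSpace ℝ (Fin 3)),
      L = WithLp.toLp 2 ((c / c₀) • w) :: l.map (fun u => WithLp.toLp 2 u) := ⟨_, rfl⟩
  have hLlen : L.length = m + 1 := by rw [hLdef]; simpa using hl
  have hLne : ∀ u ∈ L, u ≠ 0 := by
    rw [hLdef]
    intro u hu
    rw [List.mem_cons] at hu
    rcases hu with rfl | hu
    · have h1 : w ≠ 0 := hl0 w (by simp)
      simpa [hc, hc₀] using h1
    · obtain ⟨u', hu', rfl⟩ := List.mem_map.1 hu
      have h1 : u' ≠ 0 := hl0 u' (by simp [hu'])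
      simpa using h1
  have hprod : MvPolynomial.C c₀ * (L.map (fun v => mxLin (fun i => v i))).prod
      = MvPolynomial.C c * (((w :: l)).map mxLin).prod := by
    have h1 : mxLin ((c / c₀) • w) = MvPolynomial.C (c / c₀) * mxLin w := by
      simp only [mxLin, Finset.mul_sum, Pi.smul_apply, smul_eq_mul, MvPolynomial.C_mul, mul_assoc]
    have h2 : MvPolynomial.C c = MvPolynomial.C (σ := Fin 3) c₀ * MvPolynomial.C (c / c₀) := by
      rw [← MvPolynomial.C_mul, mul_div_cancel₀ _ hc₀]
    have h3 : (L.map (fun v => mxLin (fun i => v i))) = mxLin ((c / c₀) • w) :: l.map mxLin := by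
      rw [hLdef, List.map_cons, List.map_map]
      rfl
    rw [h3, List.map_cons, List.prod_cons, List.prod_cons, h1, h2]
    ring
  obtain ⟨H, a1, a2, a3, a4⟩ := hF L hLlen 1 (fun x => ‖x‖⁻¹) (MvPolynomial.isHomogeneous_one _ _)
    (by simp [mxLap]) (by intro x _; simp)
  rw [zero_add] at a1
  have hH : ψ = H := by
    rw [← sub_eq_zero]
    refine MvPolynomial.mxZero (hψ.sub a1) ?_ ?_
    · rw [sub_eq_add_neg, MvPolynomial.mxLap_add, hLψ]
      have := MvPolynomial.mxLap_C_mul (-1) H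
      rw [a2] at this
      simpa using this
    · rw [mul_one, hprod] at a3
      simpa using dvd_sub hd a3
  refine ⟨fun i => L.get (i.cast hLlen.symm), fun i => hLne _ (List.get_mem _ _), fun x hx => ?_⟩
  have hofn : List.ofFn (fun i : Fin (m + 1) => L.get (i.cast hLlen.symm)) = L := by
    apply List.ext_get
    · simp [hLlen]
    · intro i h1 h2
      rw [List.get_ofFn]
      rfl
  have hx0 : x ≠ 0 := by
    rintro rfl
    simp at hx
  unfold iterDirDeriv
  rw [hofn, a4 x hx0, hx, hH]
  simp
end

section
/- (Maxwell, uniqueness) Let n ≥ 1 and let v₁, ..., vₙ and w₁, ..., wₙ be two n-tuples of nonzero vectors in ℝ³. Define the iterated directional derivatives of x ↦ ‖x‖⁻¹ along each tuple (f₀(x) = ‖x‖⁻¹, f_k(x) = (fderiv ℝ f_{k−1} x)(v_k), and analogously g_k with the w's). If f_n and g_n agree at every point of the unit sphere and do not vanish identically on the unit sphere, then the two tuples agree up to permutation and nonzero scalar multiples: there exists a permutation σ of Fin n such that for every i there is a nonzero real c with w_i = c • v_{σ(i)}. -/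
open MvPolynomial in
theorem mmu_hasFDerivAt_eval (P : MvPolynomial (Fin 3) ℝ) (x : EuclideanSpace ℝ (Fin 3)) :
    HasFDerivAt (fun y : EuclideanSpace ℝ (Fin 3) => eval (fun i => y i) P)
      (∑ i, eval (fun i => x i) (pderiv i P) • (EuclideanSpace.proj i : EuclideanSpace ℝ (Fin 3) →L[ℝ] ℝ)) x := by
  induction P using MvPolynomial.induction_on with
  | C a => simpa using hasFDerivAt_const a x
  | add p q hp hq =>
    have := hp.add hq
    simp only [map_add, add_smul, Finset.sum_add_distrib]
    exact this
  | mul_X p j hp =>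
    have hj : HasFDerivAt (fun y : EuclideanSpace ℝ (Fin 3) => y j)
        (EuclideanSpace.proj j : EuclideanSpace ℝ (Fin 3) →L[ℝ] ℝ) x :=
      (EuclideanSpace.proj j : EuclideanSpace ℝ (Fin 3) →L[ℝ] ℝ).hasFDerivAt
    have := hp.mul hj
    simp only [map_mul, eval_X]
    refine this.congr_fderiv ?_
    ext v
    simp only [Derivation.leibniz, pderiv_X, smul_eq_mul, map_add, map_mul, eval_X]
    simp only [add_apply, smul_apply,
      sum_apply, smul_eq_mul, PiLp.proj_apply, add_mul,
      Finset.sum_add_distrib, Finset.mul_sum]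
    congr 1
    · rw [Finset.sum_eq_single j]
      · simp
      · intro b _ hb
        simp [Pi.single_apply, hb.symm]
      · simp
    · exact Finset.sum_congr rfl fun i _ => by ring

theorem mmu_hasFDerivAt_inv_norm (x : EuclideanSpace ℝ (Fin 3)) (hx : x ≠ 0) :
    HasFDerivAt (fun y : EuclideanSpace ℝ (Fin 3) => ‖y‖⁻¹)
      (-(‖x‖⁻¹ ^ 3) • innerSL ℝ x) x := by
  have hn : ‖x‖ ≠ 0 := norm_ne_zero_iff.mpr hx
  have h1 := ((hasStrictFDerivAt_norm_sq x).hasFDerivAt.sqrt (by positivity))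
  have h2 : HasFDerivAt (fun y : EuclideanSpace ℝ (Fin 3) => ‖y‖) (‖x‖⁻¹ • innerSL ℝ x) x := by
    simp only [Real.sqrt_sq (norm_nonneg _)] at h1
    refine h1.congr_fderiv ?_
    ext v
    simp
    field_simp
  have h3 := (hasDerivAt_inv hn).comp_hasFDerivAt x h2
  refine h3.congr_fderiv ?_
  ext v
  simp
  field_simp

/-- the quadratic polynomial attached to a vector -/
noncomputable def mmuZ : Fin 3 → Polynomial ℂ :=
  ![Polynomial.X ^ 2 - 1, Polynomial.C Complex.I * (Polynomial.X ^ 2 + 1), 2 * Polynomial.X]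

noncomputable def mmuQ (u : EuclideanSpace ℝ (Fin 3)) : Polynomial ℂ :=
  ∑ i, Polynomial.C (u i : ℂ) * mmuZ i

open MvPolynomial in
noncomputable def mmuR : MvPolynomial (Fin 3) ℝ := ∑ i, X i ^ 2

open MvPolynomial in
noncomputable def mmuL (u : EuclideanSpace ℝ (Fin 3)) : MvPolynomial (Fin 3) ℝ :=
  ∑ i, C (u i) * X i

open MvPolynomial in
noncomputable def mmuD (u : EuclideanSpace ℝ (Fin 3)) (P : MvPolynomial (Fin 3) ℝ) :
    MvPolynomial (Fin 3) ℝ :=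
  ∑ i, C (u i) * pderiv i P

open MvPolynomial in
theorem mmu_hom (u : EuclideanSpace ℝ (Fin 3)) (P : MvPolynomial (Fin 3) ℝ) (n : ℕ)
    (hP : P.IsHomogeneous n) (c : ℝ) :
    (mmuR * mmuD u P - C c * (mmuL u * P)).IsHomogeneous (n + 1) := by
  have hR : mmuR.IsHomogeneous 2 :=
    IsHomogeneous.sum _ _ _ fun i _ => by simpa using (isHomogeneous_X ℝ i).pow 2
  have hL : (mmuL u).IsHomogeneous 1 :=
    IsHomogeneous.sum _ _ _ fun i _ => by
      simpa using (isHomogeneous_C (Fin 3) (u i)).mul (isHomogeneous_X ℝ i)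
  have h2 : (C c * (mmuL u * P)).IsHomogeneous (n + 1) := by
    have := (isHomogeneous_C (Fin 3) c).mul (hL.mul hP)
    rwa [zero_add, add_comm 1 n] at this
  refine IsHomogeneous.sub ?_ h2
  rcases n with _ | n
  · have h0 : P = C (coeff 0 P) :=
      totalDegree_eq_zero_iff_eq_C.mp ((totalDegree_zero_iff_isHomogeneous _).mpr hP)
    have : mmuD u P = 0 := by
      rw [h0]; simp [mmuD]
    rw [this, mul_zero]
    exact isHomogeneous_zero _ _ _
  · have hD : (mmuD u P).IsHomogeneous n :=
      IsHomogeneous.sum _ _ _ fun i _ => by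
        simpa using (isHomogeneous_C (Fin 3) (u i)).mul (hP.pderiv (i := i))
    have := hR.mul hD
    rwa [show 2 + n = n + 1 + 1 by omega] at this

theorem mmu_aeval_R : MvPolynomial.aeval mmuZ mmuR = (0 : Polynomial ℂ) := by
  have hI : (Polynomial.C Complex.I) ^ 2 = (-1 : Polynomial ℂ) := by
    rw [← Polynomial.C_pow, Complex.I_sq]; simp
  simp only [mmuR, mmuZ, map_sum, map_pow, MvPolynomial.aeval_X, Fin.sum_univ_three]
  simp
  linear_combination (Polynomial.X ^ 2 + 1) ^ 2 * hI

theorem mmu_aeval_L (u : EuclideanSpace ℝ (Fin 3)) :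
    MvPolynomial.aeval mmuZ (mmuL u) = mmuQ u := by
  simp only [mmuL, mmuQ, map_sum, map_mul, MvPolynomial.aeval_X, MvPolynomial.aeval_C]
  rfl

open MvPolynomial in
theorem mmu_step (P : MvPolynomial (Fin 3) ℝ) (u x : EuclideanSpace ℝ (Fin 3)) (hx : x ≠ 0)
    (n : ℕ) :
    fderiv ℝ (fun x : EuclideanSpace ℝ (Fin 3) =>
      eval (fun i => x i) P * (‖x‖⁻¹) ^ (2 * n + 1)) x u
      = eval (fun i => x i) (mmuR * mmuD u P - C (2 * (n : ℝ) + 1) * (mmuL u * P))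
        * (‖x‖⁻¹) ^ (2 * (n + 1) + 1) := by
  have hd := (mmu_hasFDerivAt_eval P x).mul
    ((mmu_hasFDerivAt_inv_norm x hx).pow (2 * n + 1))
  rw [HasFDerivAt.fderiv (f := fun x : EuclideanSpace ℝ (Fin 3) =>
      eval (fun i => x i) P * (‖x‖⁻¹) ^ (2 * n + 1)) hd]
  have hn : ‖x‖ ≠ 0 := norm_ne_zero_iff.mpr hx
  have hR : eval (fun i => x i) mmuR = ‖x‖ ^ 2 := by
    rw [EuclideanSpace.real_norm_sq_eq]; simp [mmuR]
  have hL : eval (fun i => x i) (mmuL u) = inner ℝ x u := by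
    simp [mmuL, PiLp.inner_apply]
  have hD : (∑ i, eval (fun i => x i) (pderiv i P) •
      (EuclideanSpace.proj i : EuclideanSpace ℝ (Fin 3) →L[ℝ] ℝ)) u
      = eval (fun i => x i) (mmuD u P) := by
    simp [mmuD, sum_apply, mul_comm]
  simp only [add_apply, smul_apply, hD]
  simp only [map_sub, map_mul, hR, hL, eval_C, smul_apply, smul_eq_mul,
    innerSL_apply_apply, nsmul_eq_mul]
  generalize eval (fun i => x i) (mmuD u P) = A
  generalize eval (fun i => x i) P = B
  generalize inner ℝ x u = G
  simp only [show 2 * (n + 1) + 1 = 2 * n + 3 by ring,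
    show 2 * n + 1 - 1 = 2 * n by omega, pow_add, inv_pow]
  push_cast
  field_simp
  ring

open MvPolynomial in
theorem mmu_rep (l : List (EuclideanSpace ℝ (Fin 3))) :
    ∃ P : MvPolynomial (Fin 3) ℝ, P.IsHomogeneous l.length ∧
      (∀ x : EuclideanSpace ℝ (Fin 3), x ≠ 0 →
        l.foldl (fun f u => fun x => fderiv ℝ f x u) (fun x => ‖x‖⁻¹) x
          = eval (fun i => x i) P * (‖x‖⁻¹) ^ (2 * l.length + 1)) ∧
      aeval mmuZ P = Polynomial.C (∏ i ∈ Finset.range l.length, (-(2 * (i : ℂ) + 1)))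
        * (l.map mmuQ).prod := by
  induction l using List.reverseRecOn with
  | nil => exact ⟨1, isHomogeneous_one _ _, by simp, by simp⟩
  | append_singleton l u ih =>
    obtain ⟨P, hP, hf, hz⟩ := ih
    refine ⟨mmuR * mmuD u P - C (2 * (l.length : ℝ) + 1) * (mmuL u * P), ?_, ?_, ?_⟩
    · rw [List.length_append, List.length_singleton]
      exact mmu_hom u P _ hP _
    · intro x hx
      simp only [List.foldl_append, List.foldl_cons, List.foldl_nil, List.length_append,
        List.length_singleton]
      generalize l.foldl (fun f u => fun x => fderiv ℝ f x u) (fun x => ‖x‖⁻¹) = F at hf ⊢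
      have hev : F =ᶠ[nhds x]
          fun x => eval (fun i => x i) P * (‖x‖⁻¹) ^ (2 * l.length + 1) :=
        Filter.eventually_of_mem (isOpen_ne.mem_nhds hx) (fun y hy => hf y hy)
      rw [hev.fderiv_eq]
      exact mmu_step P u x hx l.length
    · simp only [map_sub, map_mul, mmu_aeval_R, mmu_aeval_L, hz, zero_mul, zero_sub,
        List.map_append, List.prod_append, List.length_append, List.length_singleton,
        Finset.prod_range_succ, List.map_cons, List.map_nil, List.prod_singleton]
      rw [aeval_C]
      have : algebraMap ℝ (Polynomial ℂ) (2 * (l.length : ℝ) + 1)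
          = Polynomial.C (2 * (l.length : ℂ) + 1) := by
        rw [Polynomial.algebraMap_apply]; simp
      rw [this]
      simp only [map_neg]
      ring

theorem mmu_eval (u : EuclideanSpace ℝ (Fin 3)) (s : ℂ) :
    (mmuQ u).eval s = u 0 * (s ^ 2 - 1) + u 1 * (Complex.I * (s ^ 2 + 1)) + u 2 * (2 * s) := by
  simp [mmuQ, mmuZ, Fin.sum_univ_three]

theorem mmu_root (u : EuclideanSpace ℝ (Fin 3)) (hu : u ≠ 0) : ∃ s, (mmuQ u).eval s = 0 := by
  by_contra hcon
  push Not at hcon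
  have hdeg : (mmuQ u).degree = 0 := by
    by_contra h
    obtain ⟨s, hs⟩ := Complex.isAlgClosed.exists_root _ h
    exact hcon s hs
  have hq := Polynomial.eq_C_of_degree_eq_zero hdeg
  have he : ∀ s t, (mmuQ u).eval s = (mmuQ u).eval t := by
    intro s t; rw [hq]; simp
  have h1 := he 1 (-1)
  have h2 := he 1 0
  rw [mmu_eval, mmu_eval] at h1 h2
  have a1 := congrArg Complex.re h1
  have a2 := congrArg Complex.re h2
  have a3 := congrArg Complex.im h2
  simp at a1 a2 a3
  apply hu
  ext i
  fin_cases i <;> simp <;> linarith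

theorem mmu_ne_zero (u : EuclideanSpace ℝ (Fin 3)) (hu : u ≠ 0) : mmuQ u ≠ 0 := by
  intro h
  have h0 : ∀ s, (mmuQ u).eval s = 0 := by simp [h]
  have h1 := h0 1
  have h2 := h0 0
  rw [mmu_eval] at h1 h2
  have a1 := congrArg Complex.re h1
  have a2 := congrArg Complex.re h2
  have a3 := congrArg Complex.im h2
  simp at a1 a2 a3
  apply hu
  ext i
  fin_cases i <;> simp <;> linarith

theorem mmu_smul (c : ℝ) (u : EuclideanSpace ℝ (Fin 3)) :
    mmuQ (c • u) = Polynomial.C (c : ℂ) * mmuQ u := by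
  simp [mmuQ, Finset.mul_sum, mul_assoc]

theorem mmu_prop (v w : EuclideanSpace ℝ (Fin 3)) (hv : v ≠ 0) (hw : w ≠ 0) (s : ℂ)
    (h1 : (mmuQ v).eval s = 0) (h2 : (mmuQ w).eval s = 0) : ∃ c : ℝ, c ≠ 0 ∧ w = c • v := by
  -- both are parallel to `N`, the stereographic image of the root
  have key : ∀ u : EuclideanSpace ℝ (Fin 3), (mmuQ u).eval s = 0 →
      ∃ c : ℝ, u 0 = c * (2 * s.re) ∧ u 1 = c * (-2 * s.im) ∧
        u 2 = c * (1 - s.re ^ 2 - s.im ^ 2) := by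
    intro u hu
    rw [mmu_eval] at hu
    have a1 := congrArg Complex.re hu
    have a2 := congrArg Complex.im hu
    simp [pow_two] at a1 a2
    have hM : (1 + s.re ^ 2 + s.im ^ 2) ≠ 0 := by positivity
    refine ⟨(u 0 * (2 * s.re) + u 1 * (-2 * s.im) + u 2 * (1 - s.re ^ 2 - s.im ^ 2)) /
      (1 + s.re ^ 2 + s.im ^ 2) ^ 2, ?_, ?_, ?_⟩ <;> field_simp
    · linear_combination (s.re ^ 2 - s.im ^ 2 - 1) * a1 + (2 * s.re * s.im) * a2
    · linear_combination (-2 * s.re * s.im) * a1 + (s.re ^ 2 - s.im ^ 2 + 1) * a2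
    · linear_combination (2 * s.re) * a1 + (2 * s.im) * a2
  obtain ⟨a, a0, a1, a2⟩ := key v h1
  obtain ⟨b, b0, b1, b2⟩ := key w h2
  have ha : a ≠ 0 := by
    rintro rfl
    apply hv
    ext i
    fin_cases i <;> simp [a0, a1, a2]
  have hb : b ≠ 0 := by
    rintro rfl
    apply hw
    ext i
    fin_cases i <;> simp [b0, b1, b2]
  refine ⟨b / a, div_ne_zero hb ha, ?_⟩
  ext i
  fin_cases i <;> simp [a0, a1, a2, b0, b1, b2] <;> field_simp

theorem mmu_match (n : ℕ) : ∀ (v w : Fin n → EuclideanSpace ℝ (Fin 3)),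
    (∀ i, v i ≠ 0) → (∀ i, w i ≠ 0) → ∀ c : ℂ, c ≠ 0 →
    Polynomial.C c * ∏ i, mmuQ (v i) = ∏ i, mmuQ (w i) →
    ∃ σ : Equiv.Perm (Fin n), ∀ i : Fin n, ∃ c : ℝ, c ≠ 0 ∧ w i = c • v (σ i) := by
  induction n with
  | zero => intro v w _ _ _ _ _; exact ⟨1, fun i => i.elim0⟩
  | succ n ih =>
    intro v w hv hw c hc h
    obtain ⟨s, hs⟩ := mmu_root (w 0) (hw 0)
    have hj : ∃ j, (mmuQ (v j)).eval s = 0 := by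
      have h' := congrArg (Polynomial.eval s) h
      rw [Fin.prod_univ_succ (fun i => mmuQ (w i)), Polynomial.eval_mul, Polynomial.eval_mul, hs,
        zero_mul, Polynomial.eval_C, mul_eq_zero, Polynomial.eval_prod,
        Finset.prod_eq_zero_iff] at h'
      rcases h' with h' | ⟨j, _, hj⟩
      · exact absurd h' hc
      · exact ⟨j, hj⟩
    obtain ⟨j, hj⟩ := hj
    obtain ⟨d, hd, hwd⟩ := mmu_prop (v j) (w 0) (hv j) (hw 0) s hj hs
    have hd' : (d : ℂ) ≠ 0 := by exact_mod_cast hd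
    have hmain : Polynomial.C (c / d) * ∏ i, mmuQ (v (j.succAbove i))
        = ∏ i : Fin n, mmuQ (w i.succ) := by
      rw [Fin.prod_univ_succ (fun i => mmuQ (w i)), Fin.prod_univ_succAbove _ j, hwd,
        mmu_smul] at h
      have hne : Polynomial.C (d : ℂ) * mmuQ (v j) ≠ 0 :=
        mul_ne_zero (by simpa using hd) (mmu_ne_zero _ (hv j))
      apply mul_left_cancel₀ hne
      rw [← h]
      have : Polynomial.C c = Polynomial.C (d : ℂ) * Polynomial.C (c / d) := by
        rw [← Polynomial.C_mul]; congr 1; field_simp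
      rw [this]; ring
    obtain ⟨σ, hσ⟩ := ih (fun i => v (j.succAbove i)) (fun i => w i.succ) (fun i => hv _)
      (fun i => hw _) (c / d) (div_ne_zero hc hd') hmain
    have hinj : Function.Injective
        (Fin.cons j (fun i => j.succAbove (σ i)) : Fin (n + 1) → Fin (n + 1)) := by
      rw [Fin.cons_injective_iff]
      refine ⟨?_, Fin.succAbove_right_injective.comp σ.injective⟩
      rintro ⟨i, hi⟩
      exact Fin.succAbove_ne _ _ hi
    refine ⟨Equiv.ofBijective _ (Finite.injective_iff_bijective.mp hinj), fun i => ?_⟩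
    refine Fin.cases ?_ (fun i => ?_) i
    · exact ⟨d, hd, by simpa using hwd⟩
    · simpa using hσ i

theorem maxwell_multipole_unique (n : ℕ) (hn : 1 ≤ n)
    (v w : Fin n → EuclideanSpace ℝ (Fin 3))
    (hv : ∀ i, v i ≠ 0) (hw : ∀ i, w i ≠ 0)
    (hagree : ∀ x : EuclideanSpace ℝ (Fin 3), ‖x‖ = 1 → iterDirDeriv v x = iterDirDeriv w x)
    (hnonzero : ∃ x : EuclideanSpace ℝ (Fin 3), ‖x‖ = 1 ∧ iterDirDeriv v x ≠ 0) :
    ∃ σ : Equiv.Perm (Fin n), ∀ i : Fin n, ∃ c : ℝ, c ≠ 0 ∧ w i = c • v (σ i) := by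
  obtain ⟨P, hP, hPf, hPz⟩ := mmu_rep (List.ofFn v)
  obtain ⟨Q, hQ, hQf, hQz⟩ := mmu_rep (List.ofFn w)
  simp only [List.length_ofFn] at hP hPf hPz hQ hQf hQz
  have hsph : ∀ x : EuclideanSpace ℝ (Fin 3), ‖x‖ = 1 →
      MvPolynomial.eval (fun i => x i) P = MvPolynomial.eval (fun i => x i) Q := by
    intro x hx
    have hx0 : x ≠ 0 := by rintro rfl; simp at hx
    have h := hagree x hx
    unfold iterDirDeriv at h
    rw [hPf x hx0, hQf x hx0, hx] at h
    simpa using h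
  have hPQ : P = Q := by
    apply MvPolynomial.funext
    intro y
    obtain ⟨r, x, hx, hy⟩ : ∃ (r : ℝ) (x : EuclideanSpace ℝ (Fin 3)), ‖x‖ = 1 ∧
        y = r • (fun i => x i) := by
      by_cases h0 : WithLp.toLp 2 y = (0 : EuclideanSpace ℝ (Fin 3))
      · obtain ⟨x, hx, _⟩ := hnonzero
        refine ⟨0, x, hx, ?_⟩
        ext i
        have := congrArg (fun z : EuclideanSpace ℝ (Fin 3) => z i) h0
        simpa using this
      · have hn0 := norm_ne_zero_iff.mpr h0
        refine ⟨‖(WithLp.toLp 2 y : EuclideanSpace ℝ (Fin 3))‖,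
          ‖(WithLp.toLp 2 y : EuclideanSpace ℝ (Fin 3))‖⁻¹ • WithLp.toLp 2 y, ?_, ?_⟩
        · rw [norm_smul, norm_inv, norm_norm, inv_mul_cancel₀ hn0]
        · ext i
          simp only [Pi.smul_apply, PiLp.smul_apply, smul_eq_mul]
          field_simp
    have hom : ∀ T : MvPolynomial (Fin 3) ℝ, T.IsHomogeneous n →
        MvPolynomial.eval (r • (fun i => x i)) T = r ^ n * MvPolynomial.eval (fun i => x i) T := by
      intro T hT
      rw [MvPolynomial.eval_eq', MvPolynomial.eval_eq', Finset.mul_sum]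
      refine Finset.sum_congr rfl fun d hd => ?_
      have hdn : d.degree = n := by
        rw [Finsupp.degree_eq_weight_one]
        exact hT (MvPolynomial.mem_support_iff.mp hd)
      rw [Finsupp.degree_eq_sum] at hdn
      simp only [Pi.smul_apply, smul_eq_mul, mul_pow, Finset.prod_mul_distrib,
        Finset.prod_pow_eq_pow_sum, hdn]
      ring
    rw [hy, hom P hP, hom Q hQ, hsph x hx]
  rw [hPQ, hQz, List.map_ofFn, List.map_ofFn, List.prod_ofFn, List.prod_ofFn] at hPz
  have hk : (∏ i ∈ Finset.range n, (-(2 * (i : ℂ) + 1))) ≠ 0 := by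
    rw [Finset.prod_ne_zero_iff]
    intro i _
    rw [neg_ne_zero]
    exact_mod_cast Nat.succ_ne_zero (2 * i)
  have heq := mul_left_cancel₀ (Polynomial.C_ne_zero.mpr hk) hPz
  exact mmu_match n v w hv hw 1 one_ne_zero (by simpa using heq.symm)
end
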